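/- arXiv:0706.1788 — 2 statements merged into one kernel-verified Lean document; each statement's English description precedes it below -/
import Mathlib

section
/- Let n₀ ≥ 3 and r ≥ n₀ + 1 be integers and let e : ℝ² → ℝ be a C^r function with e(0) = 0 and ∇e(0) = 0, such that the Hessian matrix of e at 0 is nonsingular with one positive and one negative eigenvalue, and such that the nonflatness condition (H5) holds. Then there exist integers ν₁, ν₂ with 2 ≤ ν₁, ν₂ ≤ n₀ − 1, a constant nonsingular 2×2 real matrix A, a neighbourhood W of 0 in ℝ², and real-valued functions a, b, c on W of class C^{r−2−max(ν₁,ν₂)} that are bounded and bounded away from zero on W, such that e(A k) = a(k) (k₁ − k₂^{ν₁} b(k)) (k₂ − k₁^{ν₂} c(k)) for all k = (k₁, k₂) ∈ W. -/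
open Polynomial

/-- The nonflatness condition (H5): whenever `kt` lies on the zero set `F = {k : e k = 0}`
and `f` is a `C^{r-2}` function on a neighbourhood `U` of `0` in `ℝ` with `f 0 = 0` such
that the curve `k₂ - kt₂ = f (k₁ - kt₁)` is contained in `F` near `kt`, some derivative of
`f` at `0` of order at least `2` and at most `n₀ - 1` is nonzero; similarly with the two
coordinates exchanged. -/
def NonFlatCond (e : ℝ × ℝ → ℝ) (r n₀ : ℕ) : Prop :=
  ∀ kt : ℝ × ℝ, e kt = 0 →
    (∀ U ∈ nhds (0 : ℝ), ∀ f : ℝ → ℝ, ContDiffOn ℝ (r - 2 : ℕ) f U → f 0 = 0 →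
      (∀ t ∈ U, e (kt.1 + t, kt.2 + f t) = 0) →
      ∃ m : ℕ, 2 ≤ m ∧ m ≤ n₀ - 1 ∧ iteratedDerivWithin m f U 0 ≠ 0) ∧
    (∀ U ∈ nhds (0 : ℝ), ∀ f : ℝ → ℝ, ContDiffOn ℝ (r - 2 : ℕ) f U → f 0 = 0 →
      (∀ t ∈ U, e (kt.1 + f t, kt.2 + t) = 0) →
      ∃ m : ℕ, 2 ≤ m ∧ m ≤ n₀ - 1 ∧ iteratedDerivWithin m f U 0 ≠ 0)

/-- The second derivative (Hessian) of `e : ℝ² → ℝ` at `p` in directions `u`, `v`. -/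
noncomputable def hess2 (e : ℝ × ℝ → ℝ) (p u v : ℝ × ℝ) : ℝ :=
  fderiv ℝ (fun q => fderiv ℝ e q u) p v

open Topology Filter


theorem pint (n : ℕ) : ∀ {F : Type} [NormedAddCommGroup F] [NormedSpace ℝ F] [CompleteSpace F]
    (f : (ℝ × ℝ) × ℝ → F), ContDiff ℝ n f →
    ContDiff ℝ n (fun x : ℝ × ℝ => ∫ s in (0:ℝ)..1, f (x, s)) := by
  induction n with
  | zero =>
    intro F _ _ _ f hf
    have hc : Continuous f := hf.continuous
    refine contDiff_zero.2 ?_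
    exact intervalIntegral.continuous_parametric_intervalIntegral_of_continuous' (f := fun x s => f (x, s)) (by exact hc) 0 1
  | succ n ih =>
    intro F _ _ _ f hf
    have hf1 : ContDiff ℝ 1 f := hf.of_le (by exact_mod_cast Nat.le_add_left 1 n)
    have hd : Differentiable ℝ f := hf1.differentiable (by norm_num)
    have hcf : Continuous (fderiv ℝ f) := hf1.continuous_fderiv (by norm_num)
    let f' : (ℝ × ℝ) × ℝ → ((ℝ × ℝ) →L[ℝ] F) := fun p =>
      (fderiv ℝ f p).comp (ContinuousLinearMap.inl ℝ (ℝ × ℝ) ℝ)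
    have hf'c : ContDiff ℝ n f' := by
      have : ContDiff ℝ n (fderiv ℝ f) := hf.fderiv_right (by exact_mod_cast le_refl _)
      exact this.clm_comp contDiff_const
    have hf'cont : Continuous f' := hf'c.continuous
    rw [show ((n + 1 : ℕ) : WithTop ℕ∞) = ((n : ℕ) : WithTop ℕ∞) + 1 by norm_cast,
      contDiff_succ_iff_hasFDerivAt (n := n)]
    refine ⟨fun x => ∫ s in (0:ℝ)..1, f' (x, s), ?_, ?_⟩
    · exact ih f' hf'c
    · intro x
      obtain ⟨C, hC⟩ := ((isCompact_closedBall x 1).prod (isCompact_Icc (a := (0:ℝ)) (b := 1))).exists_bound_of_continuousOn hf'cont.continuousOn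
      refine (intervalIntegral.hasFDerivAt_integral_of_dominated_of_fderiv_le
        (μ := MeasureTheory.volume) (a := 0) (b := 1) (F := fun x s => f (x, s)) (F' := fun x s => f' (x, s)) (x₀ := x)
        (s := Metric.ball x 1) (bound := fun _ => C) (Metric.ball_mem_nhds x one_pos) ?_ ?_ ?_ ?_ ?_ ?_)
      · refine Eventually.of_forall fun y => ?_
        exact (hd.continuous.comp (by fun_prop : Continuous fun s : ℝ => (y, s))).aestronglyMeasurable
      · exact (hd.continuous.comp (by fun_prop : Continuous fun s : ℝ => (x, s))).intervalIntegrable _ _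
      · exact (hf'cont.comp (by fun_prop : Continuous fun s : ℝ => (x, s))).aestronglyMeasurable
      · refine Eventually.of_forall fun t ht y hy => ?_
        refine hC (y, t) ⟨Metric.ball_subset_closedBall hy, ?_⟩
        rw [Set.uIoc_of_le zero_le_one] at ht
        exact ⟨ht.1.le, ht.2⟩
      · exact intervalIntegrable_const
      · refine Eventually.of_forall fun t ht y hy => ?_
        have h1 : HasFDerivAt f (fderiv ℝ f (y, t)) (y, t) := (hd _).hasFDerivAt
        have h2 : HasFDerivAt (fun y : ℝ × ℝ => (y, t)) (ContinuousLinearMap.inl ℝ (ℝ × ℝ) ℝ) y :=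
          hasFDerivAt_prodMk_left y t
        exact h1.comp y h2

/-- Hadamard -/
theorem hadamard (n : ℕ) (F : ℝ × ℝ → ℝ) (hF : ContDiff ℝ (n + 1 : ℕ) F) :
    ∃ G : ℝ × ℝ → ℝ, ContDiff ℝ n G ∧ ∀ x y, F (x, y) = F (0, y) + x * G (x, y) := by
  have hF1 : ContDiff ℝ 1 F := hF.of_le (by exact_mod_cast Nat.le_add_left 1 n)
  have hd : Differentiable ℝ F := hF1.differentiable (by norm_num)
  let f : (ℝ × ℝ) × ℝ → ℝ := fun p => fderiv ℝ F (p.2 * p.1.1, p.1.2) (1, 0)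
  have hf : ContDiff ℝ n f := by
    have h1 : ContDiff ℝ n (fderiv ℝ F) := hF.fderiv_right (by exact_mod_cast le_refl _)
    have h2 : ContDiff ℝ n (fun p : (ℝ × ℝ) × ℝ => (p.2 * p.1.1, p.1.2)) := by fun_prop
    exact (h1.comp h2).clm_apply contDiff_const
  refine ⟨fun x => ∫ s in (0:ℝ)..1, f (x, s), pint n f hf, ?_⟩
  intro x y
  have hder : ∀ s ∈ Set.uIcc (0:ℝ) 1, HasDerivAt (fun s : ℝ => F (s * x, y)) (x * f ((x, y), s)) s := by
    intro s _
    have h1 : HasFDerivAt F (fderiv ℝ F (s * x, y)) (s * x, y) := (hd _).hasFDerivAt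
    have h2 : HasDerivAt (fun s : ℝ => (s * x, y)) (x, 0) s := by
      have := ((hasDerivAt_id s).mul_const x).prodMk (hasDerivAt_const s y)
      simpa using this
    have h3 := h1.comp_hasDerivAt s h2
    have : fderiv ℝ F (s * x, y) (x, 0) = x * f ((x, y), s) := by
      have : ((x, 0) : ℝ × ℝ) = x • (1, 0) := by simp
      rw [this, map_smul]; simp [f]
    rw [this] at h3
    exact h3
  have hc : Continuous fun s : ℝ => f ((x, y), s) :=
    hf.continuous.comp (by fun_prop : Continuous fun s : ℝ => ((x, y), s))
  have := intervalIntegral.integral_eq_sub_of_hasDerivAt hder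
    ((continuous_const.mul hc).intervalIntegrable _ _)
  rw [intervalIntegral.integral_const_mul] at this
  simp only [one_mul, zero_mul] at this
  linarith

theorem glob (n : ℕ) (h : ℝ → ℝ) (hh : ContDiffAt ℝ n h 0) :
    ∃ g : ℝ → ℝ, ContDiff ℝ n g ∧ g =ᶠ[𝓝 0] h := by
  obtain ⟨u, hu, hcu⟩ := hh.contDiffOn (m := n) le_rfl (by simp)
  obtain ⟨ε, hε, hεu⟩ := Metric.mem_nhds_iff.1 hu
  let f : ContDiffBump (0:ℝ) := ⟨ε / 4, ε / 2, by linarith, by linarith⟩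
  refine ⟨fun x => f x * h x, ?_, ?_⟩
  · rw [contDiff_iff_contDiffAt]
    intro x
    by_cases hx : x ∈ Metric.ball (0:ℝ) ε
    · have h1 : ContDiffAt ℝ n h x := (hcu.mono hεu).contDiffAt (Metric.isOpen_ball.mem_nhds hx)
      exact f.contDiffAt.mul h1
    · have : x ∉ tsupport f := by
        rw [f.tsupport_eq]
        intro hx'
        apply hx
        simp only [Metric.mem_closedBall, Metric.mem_ball] at *
        have : f.rOut = ε / 2 := rfl
        linarith
      have h2 : f =ᶠ[𝓝 x] 0 := notMem_tsupport_iff_eventuallyEq.1 this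
      have h3 : (fun x => f x * h x) =ᶠ[𝓝 x] fun _ => 0 := by
        filter_upwards [h2] with y hy
        simp [hy]
      exact contDiffAt_const.congr_of_eventuallyEq h3
  · filter_upwards [f.eventuallyEq_one] with x hx
    simp [hx]

theorem ift (n : ℕ) (hn : 1 ≤ n) (Φ : ℝ × ℝ → ℝ) (hΦ : ContDiff ℝ n Φ) (h0 : Φ (0, 0) = 0)
    (d : ℝ) (hd : d ≠ 0) (hder : HasDerivAt (fun w => Φ (0, w)) d 0) :
    ∃ h : ℝ → ℝ, ContDiff ℝ n h ∧ h 0 = 0 ∧ ∀ᶠ t in 𝓝 0, Φ (t, h t) = 0 := by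
  have hn0 : (n : WithTop ℕ∞) ≠ 0 := by
    exact_mod_cast (by omega : n ≠ 0)
  have cdf : ContDiffAt ℝ n Φ (0, 0) := hΦ.contDiffAt
  have hf : HasFDerivAt Φ (fderiv ℝ Φ (0, 0)) (0, 0) := (hΦ.differentiable hn0 _).hasFDerivAt
  have hd1 : fderiv ℝ Φ (0, 0) (0, 1) = d := by
    have h2 : HasDerivAt (fun w : ℝ => ((0:ℝ), w)) (0, 1) 0 :=
      (hasDerivAt_const (0:ℝ) (0:ℝ)).prodMk (hasDerivAt_id _)
    exact (hf.comp_hasDerivAt (0:ℝ) h2).unique hder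
  have if₂ : (fderiv ℝ Φ (0, 0) ∘L .inr ℝ ℝ ℝ).IsInvertible := by
    refine ⟨ContinuousLinearEquiv.unitsEquivAut ℝ (Units.mk0 d hd), ?_⟩
    ext
    simp [hd1]
  obtain ⟨h, hc, he⟩ := glob n _ (cdf.contDiffAt_implicitFunction hn0 if₂)
  refine ⟨h, hc, ?_, ?_⟩
  · rw [he.eq_of_nhds]
    exact cdf.implicitFunction_apply_self hn0 if₂
  · have := cdf.eventually_apply_implicitFunction hn0 if₂
    filter_upwards [he, this] with t h1 h2
    rw [h1, h2, h0]

theorem L2aux (n : ℕ) (f : ℝ → ℝ) (hf : ContDiff ℝ n f)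
    (ho : f =o[𝓝 0] fun x => x ^ n) : ∀ k ≤ n, iteratedDeriv k f 0 = 0 := by
  intro k
  induction k using Nat.strong_induction_on with
  | _ k ih =>
  intro hk
  have h1 := taylor_isLittleO_univ (x₀ := 0) (hf.of_le (by exact_mod_cast hk : (k : WithTop ℕ∞) ≤ n))
  have h2 : ∀ x, taylorWithinEval f k Set.univ 0 x = iteratedDeriv k f 0 / (k.factorial) * x ^ k := by
    intro x
    rw [taylor_within_apply, Finset.sum_range_succ, Finset.sum_eq_zero]
    · simp [iteratedDerivWithin_univ]; ring
    · intro i hi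
      have hi := Finset.mem_range.1 hi
      rw [iteratedDerivWithin_univ, ih i hi (by omega)]
      simp
  simp only [h2, sub_zero] at h1
  have h3 : (fun x : ℝ => x ^ n) =O[𝓝 0] fun x => x ^ k := by
    obtain ⟨j, rfl⟩ := Nat.exists_eq_add_of_le hk
    have : (fun x : ℝ => x ^ j) =O[𝓝 0] fun _ => (1:ℝ) :=
      (by fun_prop : Continuous fun x : ℝ => x ^ j).continuousAt.tendsto.isBigO_one ℝ
    simpa [pow_add] using (Asymptotics.isBigO_refl (fun x : ℝ => x ^ k) (𝓝 0)).mul this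
  have h4 := (ho.trans_isBigO h3).sub h1
  simp only [sub_sub_cancel] at h4
  have h5 : (fun _ : ℝ => iteratedDeriv k f 0 / (k.factorial)) =o[𝓝[≠] 0] fun _ => (1:ℝ) := by
    have h6 := (h4.mono nhdsWithin_le_nhds : _ =o[𝓝[≠] (0:ℝ)] _).mul_isBigO
      (Asymptotics.isBigO_refl (fun x : ℝ => (x ^ k)⁻¹) (𝓝[≠] 0))
    refine h6.congr' ?_ ?_
    · filter_upwards [self_mem_nhdsWithin] with x hx
      have : x ≠ 0 := hx
      field_simp
    · filter_upwards [self_mem_nhdsWithin] with x hx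
      have : x ≠ 0 := hx
      field_simp
  rw [Asymptotics.isLittleO_one_iff] at h5
  have h7 := tendsto_nhds_unique h5 tendsto_const_nhds
  have : (k.factorial : ℝ) ≠ 0 := by exact_mod_cast k.factorial_ne_zero
  have h8 : iteratedDeriv k f 0 / (k.factorial : ℝ) = 0 := h7.symm
  simpa [this] using h8

theorem L2 (n : ℕ) (f : ℝ → ℝ) (hf : ContDiff ℝ n f) (l : ℝ)
    (ho : (fun x => f x - l * x) =o[𝓝 0] fun x => x ^ n) (k : ℕ) (hk2 : 2 ≤ k) (hk : k ≤ n) :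
    iteratedDeriv k f 0 = 0 := by
  have hlin : ContDiff ℝ n (fun x : ℝ => l * x) := by fun_prop
  have h1 := L2aux n _ (hf.sub hlin) ho k hk
  have hk' : (k : WithTop ℕ∞) ≤ n := by exact_mod_cast hk
  change iteratedDeriv k (f - fun x => l * x) 0 = 0 at h1
  rw [iteratedDeriv_sub ((hf.of_le hk').contDiffAt) ((hlin.of_le hk').contDiffAt)] at h1
  have h2 : iteratedDeriv k (fun x : ℝ => l * x) 0 = 0 := by
    obtain ⟨j, rfl⟩ := Nat.exists_eq_add_of_le hk2
    have hd : deriv (fun x : ℝ => l * x) = fun _ => l := by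
      ext x; simp
    rw [show 2 + j = (j + 1) + 1 by ring, iteratedDeriv_succ', hd]
    simp [iteratedDeriv_const]
  rw [h2, sub_zero] at h1
  exact h1

theorem dichot (n : ℕ) (h : ℝ → ℝ) (hh : ContDiff ℝ n h) : ∀ j ≤ n,
    (∃ i < j, ∃ b : ℝ → ℝ, ContDiff ℝ (n - i : ℕ) b ∧ b 0 ≠ 0 ∧ ∀ t, h t = t ^ i * b t) ∨
    (∃ b : ℝ → ℝ, ContDiff ℝ (n - j : ℕ) b ∧ ∀ t, h t = t ^ j * b t) := by
  intro j
  induction j with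
  | zero => intro _; exact Or.inr ⟨h, by simpa using hh, by simp⟩
  | succ j ih =>
    intro hj
    rcases ih (by omega) with ⟨i, hi, b, hb⟩ | ⟨b, hb, hbe⟩
    · exact Or.inl ⟨i, by omega, b, hb⟩
    · by_cases h0 : b 0 = 0
      · right
        have hn : n - j = (n - (j + 1)) + 1 := by omega
        rw [hn] at hb
        obtain ⟨G, hG, hGe⟩ := hadamard _ (fun p : ℝ × ℝ => b p.1) (hb.comp contDiff_fst)
        refine ⟨fun t => G (t, 0), hG.comp (by fun_prop), fun t => ?_⟩
        have := hGe t 0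
        simp only [h0, zero_add] at this
        rw [hbe, this]; ring
      · exact Or.inl ⟨j, by omega, b, hb, h0, hbe⟩

theorem hd0 (R : ℝ → ℝ) (hR : Continuous R) : HasDerivAt (fun t => t * R t) (R 0) 0 := by
  rw [hasDerivAt_iff_tendsto_slope]
  have h1 : Tendsto R (𝓝[≠] 0) (𝓝 (R 0)) := hR.continuousAt.tendsto.mono_left nhdsWithin_le_nhds
  refine h1.congr' ?_
  filter_upwards [self_mem_nhdsWithin] with x hx
  have : x ≠ 0 := hx
  simp [slope_def_field]
  field_simp

theorem blowup (m : ℕ) (hm : 1 ≤ m) (e : ℝ × ℝ → ℝ) (he : ContDiff ℝ (m + 2 : ℕ) e)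
    (he0 : e 0 = 0) (hgrad : fderiv ℝ e 0 = 0) (u v : ℝ × ℝ) :
    ∃ Φ : ℝ × ℝ → ℝ, ContDiff ℝ m Φ ∧ (∀ t w : ℝ, e (t • (u + w • v)) = t ^ 2 * Φ (t, w)) ∧
      ∀ w : ℝ, 2 * Φ (0, w) = fderiv ℝ (fderiv ℝ e) 0 (u + w • v) (u + w • v) := by
  have hde : Differentiable ℝ e := he.differentiable (by norm_cast)
  have hf1 : ContDiff ℝ (m + 1 : ℕ) (fderiv ℝ e) := he.fderiv_right (by norm_cast)
  have hdf : Differentiable ℝ (fderiv ℝ e) := hf1.differentiable (by norm_cast)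
  have hlin : ∀ (x : ℝ × ℝ) (t : ℝ), HasDerivAt (fun t : ℝ => t • x) x t := by
    intro x t
    simpa using (hasDerivAt_id t).smul_const x
  have hdt : ∀ (x : ℝ × ℝ) (t : ℝ), HasDerivAt (fun t : ℝ => e (t • x)) (fderiv ℝ e (t • x) x) t := by
    intro x t
    exact (hde _).hasFDerivAt.comp_hasDerivAt t (hlin x t)
  obtain ⟨G1, hG1, hG1e⟩ := hadamard (m + 1) (fun p : ℝ × ℝ => e (p.1 • (u + p.2 • v)))
    (he.comp (by fun_prop))
  simp only [zero_smul, he0, zero_add] at hG1e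
  have hG10 : ∀ w, G1 (0, w) = 0 := by
    intro w
    have h1 := hd0 (fun t => G1 (t, w)) (hG1.continuous.comp (by fun_prop))
    have h2 := hdt (u + w • v) 0
    simp only [hG1e] at h2
    have h3 := h1.unique h2
    simpa [hgrad] using h3
  obtain ⟨G2, hG2, hG2e⟩ := hadamard m G1 hG1
  simp only [hG10, zero_add] at hG2e
  refine ⟨G2, hG2, ?_, ?_⟩
  · intro t w
    rw [hG1e, hG2e]; ring
  · intro w
    set x := u + w • v with hx
    have hR : ContDiff ℝ 1 (fun t => G2 (t, w)) :=
      (hG2.of_le (by exact_mod_cast hm)).comp (by fun_prop)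
    have hRd : Differentiable ℝ (fun t => G2 (t, w)) := hR.differentiable (by norm_num)
    have hRc : Continuous (deriv (fun t => G2 (t, w))) := hR.continuous_deriv (by norm_num)
    have hE : ∀ t, fderiv ℝ e (t • x) x = t * (2 * G2 (t, w) + t * deriv (fun t => G2 (t, w)) t) := by
      intro t
      have h1 := hdt x t
      have h2 : HasDerivAt (fun t : ℝ => t ^ 2 * G2 (t, w)) _ t :=
        (hasDerivAt_pow 2 t).mul (hRd t).hasDerivAt
      have h3 : (fun t : ℝ => e (t • x)) = (fun t : ℝ => t ^ 2 * G2 (t, w)) := by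
        ext t
        rw [hx, hG1e, hG2e]; ring
      rw [h3] at h1
      rw [h1.unique h2]
      push_cast
      ring
    have h4 := hd0 (fun t => 2 * G2 (t, w) + t * deriv (fun t => G2 (t, w)) t)
      ((continuous_const.mul hR.continuous).add (continuous_id.mul hRc))
    simp only [← hE] at h4
    have h6 : HasFDerivAt (fderiv ℝ e) (fderiv ℝ (fderiv ℝ e) ((0:ℝ) • x)) ((0:ℝ) • x) :=
      (hdf _).hasFDerivAt
    have h7 := h6.comp_hasDerivAt (0:ℝ) (hlin x 0)
    have h8 := (h7.clm_apply (hasDerivAt_const (0:ℝ) x)).unique h4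
    simp at h8
    exact h8.symm

theorem branch (m : ℕ) (hm : 1 ≤ m) (e : ℝ × ℝ → ℝ) (he : ContDiff ℝ (m + 2 : ℕ) e)
    (he0 : e 0 = 0) (hgrad : fderiv ℝ e 0 = 0) (u v : ℝ × ℝ)
    (huu : fderiv ℝ (fderiv ℝ e) 0 u u = 0) (hvv : fderiv ℝ (fderiv ℝ e) 0 v v = 0)
    (huv : fderiv ℝ (fderiv ℝ e) 0 u v = fderiv ℝ (fderiv ℝ e) 0 v u)
    (hne : fderiv ℝ (fderiv ℝ e) 0 u v ≠ 0) :
    ∃ h : ℝ → ℝ, ContDiff ℝ m h ∧ h 0 = 0 ∧ ∀ᶠ t in 𝓝 0, e (t • u + (t * h t) • v) = 0 := by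
  obtain ⟨Φ, hΦ, hΦe, hΦ0⟩ := blowup m hm e he he0 hgrad u v
  have h1 : ∀ w, Φ (0, w) = w * fderiv ℝ (fderiv ℝ e) 0 u v := by
    intro w
    have := hΦ0 w
    simp [huu, hvv, ← huv] at this
    linarith
  obtain ⟨h, hh, h0, hz⟩ := ift m hm Φ hΦ (by simp [h1]) _ hne (by
    simp only [h1]
    simpa using (hasDerivAt_id (0:ℝ)).mul_const (fderiv ℝ (fderiv ℝ e) 0 u v))
  refine ⟨h, hh, h0, ?_⟩
  filter_upwards [hz] with t ht
  have := hΦe t (h t)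
  rw [ht, smul_add, smul_smul] at this
  simpa using this

theorem noflat1 (e : ℝ × ℝ → ℝ) (r n₀ : ℕ) (hn₀ : 3 ≤ n₀) (hr : n₀ + 1 ≤ r)
    (hcond : ∀ U ∈ nhds (0 : ℝ), ∀ f : ℝ → ℝ, ContDiffOn ℝ (r - 2 : ℕ) f U → f 0 = 0 →
      (∀ t ∈ U, e (t, f t) = 0) →
      ∃ m : ℕ, 2 ≤ m ∧ m ≤ n₀ - 1 ∧ iteratedDerivWithin m f U 0 ≠ 0)
    (p q p' q' : ℝ) (hp : p ≠ 0) (g b : ℝ → ℝ) (hg : ContDiff ℝ (r - 2 : ℕ) g)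
    (hb : Continuous b) (hgb : ∀ t, g t = t ^ n₀ * b t)
    (hz : ∀ᶠ t in 𝓝 0, e (t * p + g t * p', t * q + g t * q') = 0) : False := by
  have hg0 : g 0 = 0 := by rw [hgb, zero_pow (by omega), zero_mul]
  have hgd : HasDerivAt g 0 0 := by
    have h1 := hd0 (fun t => t ^ (n₀ - 1) * b t) (by fun_prop)
    have h2 : (fun t => t * (t ^ (n₀ - 1) * b t)) = g := by
      ext t
      rw [hgb, ← mul_assoc, ← pow_succ', Nat.sub_add_cancel (by omega)]
    rw [h2] at h1
    simpa [show n₀ - 1 ≠ 0 by omega] using h1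
  obtain ⟨σ, hσ, hσ0, hσe⟩ := ift (r - 2) (by omega) (fun x => x.2 * p + g x.2 * p' - x.1)
    (by fun_prop) (by simp [hg0]) p hp (by
      have := (((hasDerivAt_id (0:ℝ)).mul_const p).add (hgd.mul_const p')).sub_const 0
      simpa using this)
  have hσt : Tendsto σ (𝓝 0) (𝓝 0) := by
    have := hσ.continuous.tendsto 0
    rwa [hσ0] at this
  have hfc : ContDiff ℝ (r - 2 : ℕ) (fun x => σ x * q + g (σ x) * q') := by fun_prop
  have hfz : ∀ᶠ x in 𝓝 0, e (x, σ x * q + g (σ x) * q') = 0 := by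
    filter_upwards [hσe, hσt.eventually hz] with x h1 h2
    have h3 : σ x * p + g (σ x) * p' = x := by simpa [sub_eq_zero] using h1
    rwa [h3] at h2
  obtain ⟨U, hU, hUo, h0U⟩ := eventually_nhds_iff.1 hfz
  obtain ⟨k, hk2, hk, hkne⟩ := hcond U (hUo.mem_nhds h0U) _ hfc.contDiffOn (by simp [hσ0, hg0]) hU
  rw [iteratedDerivWithin_of_isOpen hUo h0U] at hkne
  apply hkne
  refine L2 (n₀ - 1) _ (hfc.of_le (by exact_mod_cast (by omega : n₀ - 1 ≤ r - 2))) (q / p) ?_ k hk2 hk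
  have hσO : σ =O[𝓝 0] fun x => x := by
    have := ((hσ.differentiable (by exact_mod_cast (by omega : r - 2 ≠ 0))) 0).hasDerivAt.isBigO_sub
    simpa [hσ0] using this
  have h1 : (fun x => (σ x) ^ n₀ * (b (σ x) * (q' - q * p' / p))) =o[𝓝 0] fun x : ℝ => x ^ (n₀ - 1) := by
    have h2 : (fun x => b (σ x) * (q' - q * p' / p)) =O[𝓝 0] fun _ => (1:ℝ) :=
      ((hb.comp hσ.continuous).mul continuous_const).continuousAt.tendsto.isBigO_one ℝ
    have h3 := (hσO.pow n₀).mul h2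
    simp only [mul_one] at h3
    exact h3.trans_isLittleO (Asymptotics.isLittleO_pow_pow (by omega))
  refine h1.congr' ?_ EventuallyEq.rfl
  filter_upwards [hσe] with x hx
  have h3 : σ x * p + g (σ x) * p' = x := by simpa [sub_eq_zero] using hx
  have h4 : (σ x) ^ n₀ * (b (σ x) * (q' - q * p' / p)) = g (σ x) * (q' - q * p' / p) := by
    rw [hgb]; ring
  rw [h4]
  have h5 : q / p * x = q / p * (σ x * p + g (σ x) * p') := by rw [h3]
  rw [h5]
  field_simp
  ring

theorem orderlem (e : ℝ × ℝ → ℝ) (r n₀ : ℕ) (hn₀ : 3 ≤ n₀) (hr : n₀ + 1 ≤ r)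
    (he0 : e 0 = 0) (hH5 : NonFlatCond e r n₀) (u v : ℝ × ℝ) (hu : u ≠ 0) (h : ℝ → ℝ)
    (hh : ContDiff ℝ (r - 2 : ℕ) h) (h0 : h 0 = 0)
    (hz : ∀ᶠ t in 𝓝 0, e (t • u + (t * h t) • v) = 0) :
    ∃ ν, 2 ≤ ν ∧ ν ≤ n₀ - 1 ∧ ∃ b : ℝ → ℝ, ContDiff ℝ (r - 2 - ν : ℕ) b ∧ b 0 ≠ 0 ∧
      ∀ t, t * h t = t ^ ν * b t := by
  rcases dichot (r - 2) h hh (n₀ - 1) (by omega) with ⟨i, hi, b, hb, hb0, hbe⟩ | ⟨b, hb, hbe⟩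
  · have hi0 : i ≠ 0 := by
      rintro rfl
      apply hb0
      have := hbe 0
      simpa [h0] using this.symm
    refine ⟨i + 1, by omega, by omega, b, hb.of_le (by exact_mod_cast (by omega)), hb0, fun t => ?_⟩
    rw [hbe]; ring
  · exfalso
    have hg : ContDiff ℝ (r - 2 : ℕ) (fun t => t * h t) := by fun_prop
    have hgb : ∀ t, t * h t = t ^ n₀ * b t := by
      intro t
      rw [hbe, ← mul_assoc, ← pow_succ', Nat.sub_add_cancel (by omega)]
    obtain ⟨c1, c2⟩ := hH5 0 he0
    by_cases hp : u.1 = 0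
    · have hq : u.2 ≠ 0 := fun hq => hu (Prod.ext hp hq)
      refine noflat1 (fun x => e (x.2, x.1)) r n₀ hn₀ hr ?_ u.2 u.1 v.2 v.1 hq _ b hg hb.continuous hgb ?_
      · intro U hU f hf hf0 hz
        exact c2 U hU f hf hf0 (by simpa using hz)
      · filter_upwards [hz] with t ht
        exact ht
    · refine noflat1 e r n₀ hn₀ hr ?_ u.1 u.2 v.1 v.2 hp _ b hg hb.continuous hgb ?_
      · intro U hU f hf hf0 hz
        exact c1 U hU f hf hf0 (by simpa using hz)
      · filter_upwards [hz] with t ht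
        exact ht

theorem nullvecs (α β γ : ℝ) (h : α * γ - β * β < 0) : ∃ x y z w : ℝ, x * w - z * y ≠ 0 ∧
    α * x * x + 2 * β * x * y + γ * y * y = 0 ∧ α * z * z + 2 * β * z * w + γ * w * w = 0 := by
  by_cases hα : α = 0
  · subst hα
    have hβ : β ≠ 0 := by rintro rfl; simp at h
    refine ⟨1, 0, γ, -2 * β, ?_, by ring, by ring⟩
    simpa using hβ
  · have hD := Real.mul_self_sqrt (show 0 ≤ β * β - α * γ by linarith)
    have hDp := Real.sqrt_pos.2 (show 0 < β * β - α * γ by linarith)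
    set D := Real.sqrt (β * β - α * γ)
    refine ⟨-β + D, α, -β - D, α, ?_, ?_, ?_⟩
    · have : (-β + D) * α - (-β - D) * α = 2 * (α * D) := by ring
      rw [this]
      exact mul_ne_zero two_ne_zero (mul_ne_zero hα hDp.ne')
    · linear_combination α * hD
    · linear_combination α * hD

theorem bddlem (a : ℝ × ℝ → ℝ) (ha : Continuous a) (h0 : a 0 ≠ 0) :
    ∀ᶠ p in 𝓝 (0 : ℝ × ℝ), |a 0| / 2 ≤ |a p| ∧ |a p| ≤ 2 * |a 0| := by
  have h1 : Tendsto (fun p => |a p|) (𝓝 0) (𝓝 |a 0|) := ha.abs.tendsto 0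
  have hp : 0 < |a 0| := abs_pos.2 h0
  filter_upwards [h1.eventually (lt_mem_nhds (show |a 0| / 2 < |a 0| by linarith)),
    h1.eventually (gt_mem_nhds (show |a 0| < 2 * |a 0| by linarith))] with p h2 h3
  exact ⟨h2.le, h3.le⟩

/-- The factorization step. -/
theorem factor (m : ℕ) (E : ℝ × ℝ → ℝ) (hE : ContDiff ℝ (m + 2 : ℕ) E) (h₁ h₂ : ℝ → ℝ)
    (hh₁ : ContDiff ℝ (m + 2 : ℕ) h₁) (hh₂ : ContDiff ℝ (m + 2 : ℕ) h₂)
    (h10 : h₁ 0 = 0) (h20 : h₂ 0 = 0)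
    (hz1 : ∀ᶠ t in 𝓝 0, E (t * h₁ t, t) = 0) (hz2 : ∀ᶠ t in 𝓝 0, E (t, t * h₂ t) = 0) :
    ∃ a : ℝ × ℝ → ℝ, ContDiff ℝ m a ∧ ∀ᶠ p in 𝓝 (0 : ℝ × ℝ),
      E p = a p * (p.1 - p.2 * h₁ p.2) * (p.2 - p.1 * h₂ p.1) := by
  obtain ⟨G, hG, hGe⟩ := hadamard (m + 1) (fun p => E (p.1 + p.2 * h₁ p.2, p.2)) (by fun_prop)
  have hh₁' : ContDiff ℝ (m + 1 : ℕ) h₁ := hh₁.of_le (by norm_cast; omega)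
  have hh₂' : ContDiff ℝ (m + 1 : ℕ) h₂ := hh₂.of_le (by norm_cast; omega)
  have hh₂'' : ContDiff ℝ m h₂ := hh₂.of_le (by norm_cast; omega)
  have hq : ∀ x y, E (x, y) = E (y * h₁ y, y) + (x - y * h₁ y) * G (x - y * h₁ y, y) := by
    intro x y
    have := hGe (x - y * h₁ y) y
    simpa using this
  obtain ⟨K, hK, hKe⟩ := hadamard m
    (fun p => G (p.2 - (p.1 + p.2 * h₂ p.2) * h₁ (p.1 + p.2 * h₂ p.2), p.1 + p.2 * h₂ p.2)) (by fun_prop)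
  have hc1 : Continuous h₁ := hh₁.continuous
  have hc2 : Continuous h₂ := hh₂.continuous
  have hcG : Continuous G := hG.continuous
  have hg2t : Tendsto (fun x => x * h₂ x) (𝓝 0) (𝓝 0) := by
    have := (by fun_prop : Continuous fun x => x * h₂ x).tendsto 0
    simpa using this
  have hzero' : ∀ᶠ x in 𝓝[≠] (0:ℝ), G (x - (x * h₂ x) * h₁ (x * h₂ x), x * h₂ x) = 0 := by
    have hne : ∀ᶠ x in 𝓝 (0:ℝ), 1 - h₂ x * h₁ (x * h₂ x) ≠ 0 := by
      have : Continuous fun x => 1 - h₂ x * h₁ (x * h₂ x) := by fun_prop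
      exact this.continuousAt.eventually_ne (by simp [h20])
    filter_upwards [self_mem_nhdsWithin, nhdsWithin_le_nhds hne, nhdsWithin_le_nhds hz2,
      nhdsWithin_le_nhds (hg2t.eventually hz1)] with x hx h1 h2 h3
    have hx : x ≠ 0 := hx
    have h4 := hq x (x * h₂ x)
    rw [h2, h3, zero_add] at h4
    have h5 : x - x * h₂ x * h₁ (x * h₂ x) ≠ 0 := by
      have : x - x * h₂ x * h₁ (x * h₂ x) = x * (1 - h₂ x * h₁ (x * h₂ x)) := by ring
      rw [this]; exact mul_ne_zero hx h1
    exact (mul_eq_zero.1 h4.symm).resolve_left h5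
  have hzero : ∀ᶠ x in 𝓝 (0:ℝ), G (x - (x * h₂ x) * h₁ (x * h₂ x), x * h₂ x) = 0 := by
    have hct : Continuous fun x => G (x - (x * h₂ x) * h₁ (x * h₂ x), x * h₂ x) := by fun_prop
    have h1 := (hct.tendsto 0).mono_left (nhdsWithin_le_nhds (s := {0}ᶜ))
    have h2 := tendsto_nhds_unique h1 (tendsto_const_nhds.congr' (hzero'.mono fun x hx => hx.symm))
    rw [eventually_nhdsWithin_iff] at hzero'
    filter_upwards [hzero'] with x hx
    by_cases h0 : x = 0
    · subst h0; exact h2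
    · exact hx h0
  refine ⟨fun p => K (p.2 - p.1 * h₂ p.1, p.1), by fun_prop, ?_⟩
  have hfst : Tendsto (fun p : ℝ × ℝ => p.1) (𝓝 0) (𝓝 0) := continuous_fst.tendsto 0
  have hsnd : Tendsto (fun p : ℝ × ℝ => p.2) (𝓝 0) (𝓝 0) := continuous_snd.tendsto 0
  filter_upwards [hfst.eventually hzero, hsnd.eventually hz1] with p h1 h2
  obtain ⟨x, y⟩ := p
  simp only at h1 h2
  have h3 := hKe (y - x * h₂ x) x
  simp only [sub_add_cancel, zero_add, h1] at h3
  rw [hq x y, h2, h3]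
  ring

/-- **Normal form near a Van Hove point.** If `e` is `C^r` with `e 0 = 0`, `∇e 0 = 0`, the
Hessian at `0` is nonsingular with one positive and one negative eigenvalue, and the
nonflatness condition (H5) holds, then near `0` one has, after a constant nonsingular
linear change of variables `A`, the factorization
`e (A k) = a k * (k₁ - k₂^ν₁ b k) * (k₂ - k₁^ν₂ c k)` with `2 ≤ ν₁, ν₂ ≤ n₀ - 1` and
`a`, `b`, `c` of class `C^{r-2-max ν₁ ν₂}`, bounded and bounded away from zero. -/
theorem stmt_1 (n₀ r : ℕ) (hn₀ : 3 ≤ n₀) (hr : n₀ + 1 ≤ r)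
    (e : ℝ × ℝ → ℝ) (he : ContDiff ℝ r e)
    (he0 : e 0 = 0) (hgrad : fderiv ℝ e 0 = 0)
    (hhess : ∃ μ₁ μ₂ : ℝ, 0 < μ₁ ∧ μ₂ < 0 ∧
      (!![hess2 e 0 (1, 0) (1, 0), hess2 e 0 (1, 0) (0, 1);
          hess2 e 0 (0, 1) (1, 0), hess2 e 0 (0, 1) (0, 1)]).charpoly
        = (X - Polynomial.C μ₁) * (X - Polynomial.C μ₂))
    (hH5 : NonFlatCond e r n₀) :
    ∃ ν₁ ν₂ : ℕ, 2 ≤ ν₁ ∧ ν₁ ≤ n₀ - 1 ∧ 2 ≤ ν₂ ∧ ν₂ ≤ n₀ - 1 ∧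
    ∃ A : Matrix (Fin 2) (Fin 2) ℝ, A.det ≠ 0 ∧
    ∃ W ∈ nhds (0 : ℝ × ℝ), ∃ a b c : ℝ × ℝ → ℝ,
      ContDiffOn ℝ (r - 2 - max ν₁ ν₂ : ℕ) a W ∧
      ContDiffOn ℝ (r - 2 - max ν₁ ν₂ : ℕ) b W ∧
      ContDiffOn ℝ (r - 2 - max ν₁ ν₂ : ℕ) c W ∧
      (∃ m M : ℝ, 0 < m ∧ ∀ p ∈ W, m ≤ |a p| ∧ |a p| ≤ M) ∧
      (∃ m M : ℝ, 0 < m ∧ ∀ p ∈ W, m ≤ |b p| ∧ |b p| ≤ M) ∧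
      (∃ m M : ℝ, 0 < m ∧ ∀ p ∈ W, m ≤ |c p| ∧ |c p| ≤ M) ∧
      ∀ p ∈ W, e (A.mulVec ![p.1, p.2] 0, A.mulVec ![p.1, p.2] 1)
        = a p * (p.1 - p.2 ^ ν₁ * b p) * (p.2 - p.1 ^ ν₂ * c p) := by
  have hr4 : 4 ≤ r := by omega
  have hN : ContDiff ℝ (r - 2 + 2 : ℕ) e := by rwa [Nat.sub_add_cancel (by omega)]
  have hf1 : ContDiff ℝ (r - 1 : ℕ) (fderiv ℝ e) := he.fderiv_right (by norm_cast; omega)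
  have hdf : Differentiable ℝ (fderiv ℝ e) := hf1.differentiable (by norm_cast; omega)
  have hhe : ∀ u v, hess2 e 0 u v = fderiv ℝ (fderiv ℝ e) 0 v u := by
    intro u v
    unfold hess2
    rw [fderiv_clm_apply (hdf 0) (differentiableAt_const u)]
    simp
  have hsym : ∀ u v, fderiv ℝ (fderiv ℝ e) 0 u v = fderiv ℝ (fderiv ℝ e) 0 v u := by
    have : IsSymmSndFDerivAt ℝ e 0 := he.contDiffAt.isSymmSndFDerivAt (by
      simp only [minSmoothness_of_isRCLikeNormedField]
      exact_mod_cast (by omega : 2 ≤ r))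
    intro u v
    exact this u v
  set B := fderiv ℝ (fderiv ℝ e) 0 with hB
  set α := B (1, 0) (1, 0) with hα
  set β := B (1, 0) (0, 1) with hβ
  set γ := B (0, 1) (0, 1) with hγ
  have hdet : α * γ - β * β < 0 := by
    obtain ⟨μ₁, μ₂, h1, h2, h3⟩ := hhess
    have h4 := congrArg (fun P => Polynomial.eval 0 P) h3
    simp only [Matrix.charpoly_fin_two, hhe, Matrix.trace_fin_two, Matrix.det_fin_two] at h4
    simp [hsym (0, 1) (1, 0), ← hα, ← hβ, ← hγ] at h4
    nlinarith
  have hexp : ∀ x y z w : ℝ, B (x, y) (z, w) = α * x * z + β * (x * w + y * z) + γ * y * w := by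
    intro x y z w
    have e1 : ∀ x y : ℝ, ((x, y) : ℝ × ℝ) = x • (1, 0) + y • (0, 1) := by intro x y; simp
    rw [e1 x y, e1 z w]
    simp only [map_add, map_smul, add_apply, smul_apply, smul_eq_mul, hsym (0, 1) (1, 0)]
    rw [← hα, ← hβ, ← hγ]
    ring
  obtain ⟨x, y, z, w, hxw, h1, h2⟩ := nullvecs α β γ hdet
  have huu : B (x, y) (x, y) = 0 := by rw [hexp]; linarith
  have hvv : B (z, w) (z, w) = 0 := by rw [hexp]; linarith
  have huv : B (x, y) (z, w) ≠ 0 := by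
    intro h3
    rw [hexp] at h3
    have h4 : (α * γ - β * β) * (x * w - z * y) ^ 2 = 0 := by
      linear_combination h1 * (α * z * z + 2 * β * z * w + γ * w * w) - h3 * (α * x * z + β * (x * w + y * z) + γ * y * w)
    rcases mul_eq_zero.1 h4 with h5 | h5
    · exact hdet.ne h5
    · exact hxw (pow_eq_zero_iff two_ne_zero |>.1 h5)
  have hu0 : ((x, y) : ℝ × ℝ) ≠ 0 := by
    intro h; rw [h] at huv; simp at huv
  have hv0 : ((z, w) : ℝ × ℝ) ≠ 0 := by
    intro h; rw [h] at huv; simp at huv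
  obtain ⟨h₂, hh₂, h20, hz2⟩ := branch (r - 2) (by omega) e hN he0 hgrad (x, y) (z, w) huu hvv
    (hsym _ _) huv
  obtain ⟨h₁, hh₁, h10, hz1⟩ := branch (r - 2) (by omega) e hN he0 hgrad (z, w) (x, y) hvv huu
    (hsym _ _) (by rw [← hB, hsym]; exact huv)
  obtain ⟨ν₁, hν1, hν1', b, hb, hb0, hbe⟩ := orderlem e r n₀ hn₀ hr he0 hH5 _ _ hv0 h₁ hh₁ h10 hz1
  obtain ⟨ν₂, hν2, hν2', c, hc, hc0, hce⟩ := orderlem e r n₀ hn₀ hr he0 hH5 _ _ hu0 h₂ hh₂ h20 hz2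
  have hE : ContDiff ℝ r (fun p : ℝ × ℝ => e (p.1 • (x, y) + p.2 • (z, w))) := by fun_prop
  have hs : r - 2 = r - 4 + 2 := by omega
  obtain ⟨a, ha, hae⟩ := factor (r - 4) (fun p : ℝ × ℝ => e (p.1 • (x, y) + p.2 • (z, w)))
    (hE.of_le (by exact_mod_cast (by omega : r - 4 + 2 ≤ r))) h₁ h₂ (hs ▸ hh₁) (hs ▸ hh₂) h10 h20
    (by
      filter_upwards [hz1] with t ht
      rw [add_comm]; exact ht)
    (by
      filter_upwards [hz2] with t ht
      exact ht)
  have ha0 : a 0 ≠ 0 := by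
    obtain ⟨Φ, hΦ, hΦe, hΦ0⟩ := blowup (r - 2) (by omega) e hN he0 hgrad (x, y) (z, w)
    have hdiag : Tendsto (fun t : ℝ => (t, t)) (𝓝[≠] 0) (𝓝 (0 : ℝ × ℝ)) :=
      ((by fun_prop : Continuous fun t : ℝ => (t, t)).tendsto 0).mono_left nhdsWithin_le_nhds
    have hcΦ : Continuous Φ := hΦ.continuous
    have hca : Continuous a := ha.continuous
    have hc1 : Continuous h₁ := hh₁.continuous
    have hc2 : Continuous h₂ := hh₂.continuous
    have hev : ∀ᶠ t in 𝓝[≠] (0:ℝ), Φ (t, 1) = a (t, t) * (1 - h₁ t) * (1 - h₂ t) := by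
      filter_upwards [self_mem_nhdsWithin, hdiag.eventually hae] with t ht h3
      have ht : t ≠ 0 := ht
      have h4 := hΦe t 1
      rw [one_smul, smul_add] at h4
      have h5 : t ^ 2 * Φ (t, 1) = t ^ 2 * (a (t, t) * (1 - h₁ t) * (1 - h₂ t)) := by
        rw [← h4, h3]; ring
      exact mul_left_cancel₀ (pow_ne_zero 2 ht) h5
    have t1 := ((by fun_prop : Continuous fun t : ℝ => Φ (t, 1)).tendsto 0).mono_left
      (nhdsWithin_le_nhds (s := {0}ᶜ))
    have t2 := ((by fun_prop : Continuous fun t : ℝ => a (t, t) * (1 - h₁ t) * (1 - h₂ t)).tendsto 0).mono_left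
      (nhdsWithin_le_nhds (s := {0}ᶜ))
    have h6 := tendsto_nhds_unique (t1.congr' hev) t2
    simp only [h10, h20, sub_zero, mul_one] at h6
    have h7 := hΦ0 1
    rw [← hB, one_smul] at h7
    simp only [map_add, add_apply, huu, hvv, hsym (z, w) (x, y), h6] at h7
    intro h8
    have h9 : a (0, 0) = 0 := h8
    rw [h9] at h7
    apply huv
    linarith
  have hbc : Continuous fun p : ℝ × ℝ => b p.2 := hb.continuous.comp continuous_snd
  have hcc : Continuous fun p : ℝ × ℝ => c p.1 := hc.continuous.comp continuous_fst
  have hW := (hae.and (bddlem a ha.continuous ha0)).and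
    ((bddlem _ hbc hb0).and (bddlem _ hcc hc0))
  refine ⟨ν₁, ν₂, hν1, hν1', hν2, hν2', !![x, z; y, w], ?_, _, hW, a, fun p => b p.2, fun p => c p.1,
    ?_, ?_, ?_, ⟨|a 0| / 2, 2 * |a 0|, by positivity, fun p hp => hp.1.2⟩,
    ⟨|b 0| / 2, 2 * |b 0|, by positivity, fun p hp => hp.2.1⟩,
    ⟨|c 0| / 2, 2 * |c 0|, by positivity, fun p hp => hp.2.2⟩, ?_⟩
  · rw [Matrix.det_fin_two_of]; exact hxw
  · exact (ha.of_le (by exact_mod_cast (by omega))).contDiffOn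
  · exact ((hb.of_le (by exact_mod_cast (by omega))).comp contDiff_snd).contDiffOn
  · exact ((hc.of_le (by exact_mod_cast (by omega))).comp contDiff_fst).contDiffOn
  · intro p hp
    have h3 := hp.1.1
    rw [hbe, hce] at h3
    rw [← h3]
    congr 1
    ext
    · simp [Matrix.mulVec, Matrix.vecHead, Matrix.vecTail]; ring
    · simp [Matrix.mulVec, Matrix.vecHead, Matrix.vecTail]; ring
end

section
/- Assume the standing hypotheses (H1)–(H6). For each p̃ ∈ ℝ² and each k̃ ∈ F there exist constants d, D' > 0 such that for each sign σ ∈ {+1, −1}, every integer j < 0, and every p ∈ ℝ² with 0 < |p − p̃| ≤ d, one has ℓ({k ∈ F : |k − k̃| ≤ d and |e(p + σ k)| ≤ M^j}) ≤ D' (M^j / |p − p̃|)^{1/n₀}. -/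
open MeasureTheory Polynomial

/-- Auxiliary to the no-nesting condition (H6): for curves `f` through `kt` lying in the
zero set of `e₁` and curves `g` through `pt` lying in the zero set of `e₂`, some derivative
of `f - g` at `0` of order at most `n₀ - 1` is nonzero (in both coordinate orientations). -/
def NestPairCond (e₁ e₂ : ℝ × ℝ → ℝ) (r n₀ : ℕ) (kt pt : ℝ × ℝ) : Prop :=
  (∀ U ∈ nhds (0 : ℝ), ∀ f g : ℝ → ℝ,
    ContDiffOn ℝ (r - 2 : ℕ) f U → ContDiffOn ℝ (r - 2 : ℕ) g U → f 0 = 0 → g 0 = 0 →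
    (∀ t ∈ U, e₁ (kt.1 + t, kt.2 + f t) = 0) →
    (∀ t ∈ U, e₂ (pt.1 + t, pt.2 + g t) = 0) →
    ∃ m : ℕ, m ≤ n₀ - 1 ∧ iteratedDerivWithin m (fun t => f t - g t) U 0 ≠ 0) ∧
  (∀ U ∈ nhds (0 : ℝ), ∀ f g : ℝ → ℝ,
    ContDiffOn ℝ (r - 2 : ℕ) f U → ContDiffOn ℝ (r - 2 : ℕ) g U → f 0 = 0 → g 0 = 0 →
    (∀ t ∈ U, e₁ (kt.1 + f t, kt.2 + t) = 0) →
    (∀ t ∈ U, e₂ (pt.1 + g t, pt.2 + t) = 0) →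
    ∃ m : ℕ, m ≤ n₀ - 1 ∧ iteratedDerivWithin m (fun t => f t - g t) U 0 ≠ 0)

/-- The no-nesting condition (H6), including the reflected condition (curves in `-F`)
when `e` is not an even function. -/
def NoNestingCond (e : ℝ × ℝ → ℝ) (r n₀ : ℕ) : Prop :=
  (∀ kt pt : ℝ × ℝ, e kt = 0 → e pt = 0 → kt ≠ pt → NestPairCond e e r n₀ kt pt) ∧
  ((¬ ∀ k : ℝ × ℝ, e (-k) = e k) →
    ∀ kt pt : ℝ × ℝ, e kt = 0 → e (-pt) = 0 →
      NestPairCond e (fun k => e (-k)) r n₀ kt pt)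

/-- (H4): the Hessian matrix of `e` at `p` is nonsingular, with one positive and one
negative eigenvalue. -/
def HessCond (e : ℝ × ℝ → ℝ) (p : ℝ × ℝ) : Prop :=
  ∃ μ₁ μ₂ : ℝ, 0 < μ₁ ∧ μ₂ < 0 ∧
    (!![hess2 e p (1, 0) (1, 0), hess2 e p (1, 0) (0, 1);
        hess2 e p (0, 1) (1, 0), hess2 e p (0, 1) (0, 1)]).charpoly
      = (X - Polynomial.C μ₁) * (X - Polynomial.C μ₂)



open Topology in
theorem param_int {E : Type} [NormedAddCommGroup E] [NormedSpace ℝ E] [ProperSpace E]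
    (n : ℕ) : ∀ {F : Type} [NormedAddCommGroup F] [NormedSpace ℝ F] [CompleteSpace F]
    (f : E × ℝ → F), ContDiff ℝ n f → ContDiff ℝ n (fun x => ∫ τ in (0:ℝ)..1, f (x, τ)) := by
  induction n with
  | zero =>
    intro F _ _ _ f hf
    have := contDiff_zero.1 hf
    refine contDiff_zero.2 ?_
    exact intervalIntegral.continuous_parametric_intervalIntegral_of_continuous'
      (f := fun x τ => f (x, τ)) (by simpa [Function.uncurry_def] using this) 0 1
  | succ n ih =>
    intro F _ _ _ f hf
    have hfd : ContDiff ℝ n (fun z : E × ℝ => (fderiv ℝ f z).comp (ContinuousLinearMap.inl ℝ E ℝ)) := by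
      have := hf.fderiv_right (m := n) (by norm_cast)
      fun_prop
    have hd := ih _ hfd
    have hdiff : ∀ z, DifferentiableAt ℝ f z := fun z =>
      hf.contDiffAt.differentiableAt (by simp)
    have key : ∀ x, HasFDerivAt (fun x => ∫ τ in (0:ℝ)..1, f (x, τ))
      (∫ τ in (0:ℝ)..1, (fderiv ℝ f (x, τ)).comp (ContinuousLinearMap.inl ℝ E ℝ)) x := by
      intro x
      have hc := hfd.continuous
      obtain ⟨C, hC⟩ := ((isCompact_closedBall x 1).prod (isCompact_Icc (a := (0:ℝ)) (b := 1))).exists_bound_of_continuousOn hc.continuousOn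
      have hfc := hf.continuous
      refine intervalIntegral.hasFDerivAt_integral_of_dominated_of_fderiv_le
        (𝕜 := ℝ) (F := fun x τ => f (x, τ)) (bound := fun _ => C)
        (F' := fun x τ => (fderiv ℝ f (x, τ)).comp (ContinuousLinearMap.inl ℝ E ℝ)) (μ := volume) (a := 0) (b := 1) (x₀ := x)
        (s := Metric.ball x 1) (Metric.ball_mem_nhds x one_pos) ?_ ?_ ?_ ?_ ?_ ?_
      · refine Filter.Eventually.of_forall fun y => Continuous.aestronglyMeasurable (by fun_prop)
      · exact Continuous.intervalIntegrable (by fun_prop) _ _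
      · exact Continuous.aestronglyMeasurable (hc.comp (f := fun τ : ℝ => (x, τ)) (by fun_prop))
      · refine Filter.Eventually.of_forall fun t ht y hy => hC (y, t) ⟨Metric.ball_subset_closedBall hy, ?_⟩
        rw [Set.uIoc_of_le zero_le_one] at ht
        exact ⟨ht.1.le, ht.2⟩
      · exact intervalIntegrable_const
      · refine Filter.Eventually.of_forall fun t ht y hy => ?_
        have h1 := (hdiff (y, t)).hasFDerivAt
        have h2 : HasFDerivAt (fun y : E => (y, t)) (ContinuousLinearMap.inl ℝ E ℝ) y :=
          hasFDerivAt_prodMk_left y t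
        exact h1.comp y h2
    rw [Nat.cast_succ, contDiff_succ_iff_hasFDerivAt]
    exact ⟨_, hd, key⟩


theorem hadamard_div {P : Type} [NormedAddCommGroup P] [NormedSpace ℝ P] [ProperSpace P]
    (n : ℕ) (g : ℝ × P → ℝ) (hg : ContDiff ℝ (n + 1 : ℕ) g) :
    ∃ G : ℝ × P → ℝ, ContDiff ℝ n G ∧ (∀ x s, g (x, s) - g (0, s) = x * G (x, s)) ∧
      ∀ s, G (0, s) = fderiv ℝ g (0, s) (1, 0) := by
  have hfd : ContDiff ℝ n (fun z : ℝ × P => fderiv ℝ g z (1, 0)) := by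
    have := hg.fderiv_right (m := n) (by norm_cast)
    fun_prop
  have hdiff : ∀ z, DifferentiableAt ℝ g z := fun z =>
      hg.contDiffAt.differentiableAt (by simp)
  refine ⟨fun z => ∫ τ in (0:ℝ)..1, fderiv ℝ g (τ * z.1, z.2) (1, 0), ?_, ?_, ?_⟩
  · exact param_int n (fun w : (ℝ × P) × ℝ => fderiv ℝ g (w.2 * w.1.1, w.1.2) (1, 0))
      (hfd.comp (g := fun z : ℝ × P => fderiv ℝ g z (1, 0))
        (f := fun w : (ℝ × P) × ℝ => (w.2 * w.1.1, w.1.2)) (by fun_prop))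
  · intro x s
    have hder : ∀ τ : ℝ, HasDerivAt (fun τ : ℝ => g (τ * x, s))
        (x * fderiv ℝ g (τ * x, s) (1, 0)) τ := by
      intro τ
      have h1 : HasDerivAt (fun τ : ℝ => (τ * x, s)) (x, (0 : P)) τ := by
        have := (hasDerivAt_id τ).mul_const x
        simpa using this.prodMk (hasDerivAt_const τ s)
      have h2 := (hdiff (τ * x, s)).hasFDerivAt.comp_hasDerivAt τ h1
      have h3 : ((x, 0) : ℝ × P) = x • ((1, 0) : ℝ × P) := by simp
      rw [h3, map_smul, smul_eq_mul] at h2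
      exact h2
    have hc := hfd.continuous
    have := intervalIntegral.integral_eq_sub_of_hasDerivAt (a := 0) (b := 1)
      (fun τ _ => hder τ) (Continuous.intervalIntegrable
        (continuous_const.mul (hc.comp (f := fun τ : ℝ => (τ * x, s)) (by fun_prop))) _ _)
    simp only [one_mul, zero_mul] at this
    rw [← this, intervalIntegral.integral_const_mul]
  · intro s
    simp

/-- all derivatives up to order m vanish at 0 implies little-o -/
theorem isLittleO_of_derivs {m : ℕ} {φ : ℝ → ℝ} (hφ : ContDiff ℝ m φ)
    (h : ∀ i ≤ m, iteratedDeriv i φ 0 = 0) : φ =o[nhds 0] fun t => t ^ m := by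
  have := taylor_isLittleO_univ (x₀ := 0) hφ
  have h0 : ∀ x, taylorWithinEval φ m Set.univ 0 x = 0 := by
    intro x
    rw [taylor_within_apply]
    refine Finset.sum_eq_zero fun k hk => ?_
    rw [iteratedDerivWithin_univ, h k (by simpa [Nat.lt_succ_iff] using hk)]
    simp
  simpa [h0] using this

theorem derivs_of_isLittleO {m : ℕ} {φ : ℝ → ℝ} (hφ : ContDiff ℝ m φ)
    (h : φ =o[nhds 0] fun t => t ^ m) : ∀ i ≤ m, iteratedDeriv i φ 0 = 0 := by
  intro i
  induction i using Nat.strong_induction_on with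
  | _ i ih =>
  intro him
  have h1 := taylor_isLittleO_univ (x₀ := 0) (hφ.of_le (by exact_mod_cast him) : ContDiff ℝ i φ)
  have h0 : ∀ x, taylorWithinEval φ i Set.univ 0 x =
      (iteratedDeriv i φ 0 / (Nat.factorial i : ℝ)) * x ^ i := by
    intro x
    rw [taylor_within_apply, Finset.sum_range_succ, Finset.sum_eq_zero, zero_add,
      iteratedDerivWithin_univ]
    · simp; ring
    · intro k hk
      have hk := Finset.mem_range.1 hk
      rw [iteratedDerivWithin_univ, ih k hk (by omega)]
      simp
  simp only [h0, sub_zero] at h1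
  have h2 : φ =o[nhds 0] fun t : ℝ => t ^ i := by
    refine h.trans_isBigO ?_
    have : (fun t : ℝ => t ^ m) = fun t => t ^ i * t ^ (m - i) := by
      funext t; rw [← pow_add]; congr 1; omega
    rw [this]
    have hb : (fun t : ℝ => t ^ (m - i)) =O[nhds 0] fun _ => (1 : ℝ) :=
      (continuous_pow (m - i)).continuousAt.norm.isBoundedUnder_le.isBigO_one ℝ
    simpa using (Asymptotics.isBigO_refl (fun t : ℝ => t ^ i) (nhds 0)).mul hb
  have h3 := h2.sub h1
  simp only [sub_sub_cancel] at h3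
  by_contra hne
  have hc : iteratedDeriv i φ 0 / (Nat.factorial i : ℝ) ≠ 0 :=
    div_ne_zero hne (by positivity)
  rw [Asymptotics.isLittleO_const_mul_left_iff hc] at h3
  have h4 := h3.mono (nhdsWithin_le_nhds (s := {0}ᶜ))
  have h5 : ∃ᶠ x in nhdsWithin (0:ℝ) {0}ᶜ, ‖(fun t : ℝ => t ^ i) x‖ ≠ 0 := by
    refine Filter.Eventually.frequently ?_
    filter_upwards [self_mem_nhdsWithin] with x hx
    simpa using fun h : x = 0 => absurd h hx
  exact Asymptotics.isLittleO_irrefl (h5.mono fun x hx => by simpa using hx) h4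

/-- the partial derivative in the first variable -/
noncomputable def pd {P : Type} [NormedAddCommGroup P] [NormedSpace ℝ P]
    (f : ℝ × P → ℝ) : ℝ × P → ℝ := fun z => fderiv ℝ f z (1, 0)

theorem pd_contDiff {P : Type} [NormedAddCommGroup P] [NormedSpace ℝ P]
    {f : ℝ × P → ℝ} {n : ℕ} (hf : ContDiff ℝ (n + 1 : ℕ) f) : ContDiff ℝ n (pd f) := by
  have := hf.fderiv_right (m := n) (by norm_cast)
  unfold pd
  fun_prop

theorem pd_hasDerivAt {P : Type} [NormedAddCommGroup P] [NormedSpace ℝ P]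
    {f : ℝ × P → ℝ} (hf : ContDiff ℝ 1 f) (t : ℝ) (s : P) :
    HasDerivAt (fun t => f (t, s)) (pd f (t, s)) t := by
  have h1 : HasDerivAt (fun τ : ℝ => (τ, s)) ((1 : ℝ), (0 : P)) t :=
    (hasDerivAt_id t).prodMk (hasDerivAt_const t s)
  exact (hf.contDiffAt.differentiableAt (by simp)).hasFDerivAt.comp_hasDerivAt t h1

theorem pd_iter_contDiff {P : Type} [NormedAddCommGroup P] [NormedSpace ℝ P]
    {f : ℝ × P → ℝ} {n : ℕ} (m : ℕ) (hf : ContDiff ℝ (n + m : ℕ) f) :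
    ContDiff ℝ n (pd^[m] f) := by
  induction m generalizing n with
  | zero => simpa using hf
  | succ m ih =>
    rw [Function.iterate_succ_apply']
    exact pd_contDiff (ih (by convert hf using 2; ring))

theorem pd_iter_eq {P : Type} [NormedAddCommGroup P] [NormedSpace ℝ P]
    {f : ℝ × P → ℝ} {n : ℕ} (hf : ContDiff ℝ n f) (s : P) (m : ℕ) (hm : m ≤ n) :
    iteratedDeriv m (fun t => f (t, s)) = fun t => pd^[m] f (t, s) := by
  induction m with
  | zero => simp
  | succ m ih =>
    rw [iteratedDeriv_succ, ih (by omega)]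
    funext t
    rw [Function.iterate_succ_apply']
    exact (pd_hasDerivAt (pd_iter_contDiff m (n := 1)
      (hf.of_le (by exact_mod_cast (by omega : 1 + m ≤ n)))) t s).deriv

/-- sublevel constant -/
def subC : ℕ → ℝ
  | 0 => 0
  | m + 1 => 2 + 2 * subC m

theorem subC_nonneg (m : ℕ) : 0 ≤ subC m := by
  induction m with
  | zero => simp [subC]
  | succ m ih => simp only [subC]; linarith

theorem subC_mono : Monotone subC := by
  refine monotone_nat_of_le_succ fun m => ?_
  have := subC_nonneg m
  simp only [subC]; linarith

theorem sublevel (m : ℕ) : ∀ (G : ℕ → ℝ → ℝ) (I : Set ℝ) (lam δ ε : ℝ), I.OrdConnected →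
    Bornology.IsBounded I → 
    0 < lam → 0 ≤ δ → ε < lam * δ ^ m → (∀ i < m, ∀ t ∈ I, HasDerivAt (G i) (G (i + 1) t) t) →
    (∀ t ∈ I, lam ≤ |G m t|) →
    volume {t | t ∈ I ∧ |G 0 t| ≤ ε} ≤ ENNReal.ofReal (subC m * δ) := by
  induction m with
  | zero =>
    intro G I lam δ ε hI hIb hlam hδ hε hG hm
    have : {t | t ∈ I ∧ |G 0 t| ≤ ε} = ∅ := by
      ext t
      simp only [Set.mem_ofPred_eq, Set.mem_empty_iff_false, iff_false, not_and, not_le]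
      intro ht
      have := hm t ht
      simp at hε
      linarith
    rw [this]; simp
  | succ m ih =>
    intro G I lam δ ε hI hIb hlam hδ hε hG hm
    rcases hδ.eq_or_lt with rfl | hδ
    · have : {t | t ∈ I ∧ |G 0 t| ≤ ε} = ∅ := by
        ext t
        simp only [Set.mem_ofPred_eq, Set.mem_empty_iff_false, iff_false, not_and, not_le]
        intro ht
        have := abs_nonneg (G 0 t)
        simp at hε
        linarith
      rw [this]; simp
    set J := {t | t ∈ I ∧ |G m t| ≤ lam * δ} with hJ
    have hη : 0 < lam * δ := by positivity
    have hsub : ∀ I' : Set ℝ, I' ⊆ I → I'.OrdConnected → (∀ t ∈ I', t ∉ J) →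
        volume {t | t ∈ I' ∧ |G 0 t| ≤ ε} ≤ ENNReal.ofReal (subC m * δ) := by
      intro I' hI' ho hn
      refine ih G I' (lam * δ) δ ε ho (hIb.subset hI') hη hδ.le ?_ ?_ ?_
      · rw [mul_assoc, ← pow_succ']; exact hε
      · exact fun i hi t ht => hG i (by omega) t (hI' ht)
      · intro t ht
        have := hn t ht
        simp only [hJ, Set.mem_ofPred_eq, not_and, not_le] at this
        exact (this (hI' ht)).le
    by_cases hne : J.Nonempty
    · have hJI : J ⊆ I := fun t ht => ht.1
      have hb : Bornology.IsBounded J := hIb.subset hJI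
      have hba := hb.bddAbove
      have hbb := hb.bddBelow
      set a := sInf J
      set b := sSup J
      have hdiam : ∀ x ∈ J, ∀ y ∈ J, x ≤ y + 2 * δ := by
        intro x hx y hy
        rcases le_or_gt x y with hxy | hxy
        · linarith
        have hIcc : Set.Icc y x ⊆ I := hI.out hy.1 hx.1
        obtain ⟨c, hc, hceq⟩ := exists_hasDerivAt_eq_slope (G m) (G (m + 1)) hxy
          (fun t ht => (hG m (by omega) t (hIcc ht)).continuousAt.continuousWithinAt)
          (fun t ht => hG m (by omega) t (hIcc ⟨ht.1.le, ht.2.le⟩))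
        have h1 := hm c (hIcc ⟨hc.1.le, hc.2.le⟩)
        rw [hceq, abs_div, abs_of_pos (sub_pos.2 hxy), le_div_iff₀ (sub_pos.2 hxy)] at h1
        have h2 := abs_sub (G m x) (G m y)
        have h3 : lam * (x - y) ≤ lam * (2 * δ) := by
          have := hx.2; have := hy.2; linarith
        have := le_of_mul_le_mul_left h3 hlam
        linarith
      have hab : b - a ≤ 2 * δ := by
        have : b ≤ a + 2 * δ := by
          refine csSup_le hne fun x hx => ?_
          have : x - 2 * δ ≤ a := le_csInf hne fun y hy => by linarith [hdiam x hx y hy]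
          linarith
        linarith
      have hcov : {t | t ∈ I ∧ |G 0 t| ≤ ε} ⊆ Set.Icc a b ∪
          ({t | t ∈ I ∩ Set.Iio a ∧ |G 0 t| ≤ ε} ∪ {t | t ∈ I ∩ Set.Ioi b ∧ |G 0 t| ≤ ε}) := by
        rintro t ⟨ht, hte⟩
        rcases lt_or_ge t a with h | h
        · exact Or.inr (Or.inl ⟨⟨ht, h⟩, hte⟩)
        rcases lt_or_ge b t with h' | h'
        · exact Or.inr (Or.inr ⟨⟨ht, h'⟩, hte⟩)
        · exact Or.inl ⟨h, h'⟩
      have hl := hsub (I ∩ Set.Iio a) Set.inter_subset_left (hI.inter Set.ordConnected_Iio)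
        (fun t ht htJ => absurd (csInf_le hbb htJ) (not_le.2 ht.2))
      have hr := hsub (I ∩ Set.Ioi b) Set.inter_subset_left (hI.inter Set.ordConnected_Ioi)
        (fun t ht htJ => absurd (le_csSup hba htJ) (not_le.2 ht.2))
      have hC := subC_nonneg m
      calc _ ≤ volume (Set.Icc a b) + (volume {t | t ∈ I ∩ Set.Iio a ∧ |G 0 t| ≤ ε} +
              volume {t | t ∈ I ∩ Set.Ioi b ∧ |G 0 t| ≤ ε}) :=
            (measure_mono hcov).trans ((measure_union_le _ _).trans
              (add_le_add le_rfl (measure_union_le _ _)))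
        _ ≤ ENNReal.ofReal (2 * δ) + (ENNReal.ofReal (subC m * δ) + ENNReal.ofReal (subC m * δ)) := by
            refine add_le_add ?_ (add_le_add hl hr)
            rw [Real.volume_Icc]
            exact ENNReal.ofReal_le_ofReal hab
        _ = _ := by
            rw [← ENNReal.ofReal_add (by positivity) (by positivity),
              ← ENNReal.ofReal_add (by positivity) (by positivity)]
            congr 1
            simp only [subC]; ring
    · have := hsub I subset_rfl hI (fun t _ htJ => hne ⟨t, htJ⟩)
      refine this.trans (ENNReal.ofReal_le_ofReal ?_)
      exact mul_le_mul_of_nonneg_right (subC_mono (Nat.le_succ m)) hδ.le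


open Topology in
theorem core_sublevel {P : Type} [NormedAddCommGroup P] [NormedSpace ℝ P]
    (n₀ N : ℕ) (hn : 0 < n₀) (hN : n₀ ≤ N) (Ψ : ℝ × P → ℝ) (hΨ : ContDiff ℝ N Ψ)
    (K : Set P) (hK : IsCompact K) (h : ∀ θ ∈ K, ∃ m ≤ n₀, pd^[m] Ψ (0, θ) ≠ 0) :
    ∃ d > 0, ∃ C > 0, ∃ W : Set P, IsOpen W ∧ K ⊆ W ∧ ∀ w ∈ W, ∀ ε > 0,
      volume {t : ℝ | |t| ≤ d ∧ |Ψ (t, w)| ≤ ε} ≤ ENNReal.ofReal (C * ε ^ ((1 : ℝ) / n₀)) := by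
  refine hK.induction_on (p := fun T => ∃ d > 0, ∃ C > 0, ∃ W : Set P, IsOpen W ∧ T ⊆ W ∧
    ∀ w ∈ W, ∀ ε > 0,
      volume {t : ℝ | |t| ≤ d ∧ |Ψ (t, w)| ≤ ε} ≤ ENNReal.ofReal (C * ε ^ ((1 : ℝ) / n₀)))
    ?_ ?_ ?_ ?_
  · exact ⟨1, one_pos, 1, one_pos, ∅, isOpen_empty, subset_rfl, by simp⟩
  · rintro S T hST ⟨d, hd, C, hC, W, hW, hTW, hb⟩
    exact ⟨d, hd, C, hC, W, hW, hST.trans hTW, hb⟩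
  · rintro S T ⟨d, hd, C, hC, W, hW, hTW, hb⟩ ⟨d', hd', C', hC', W', hW', hTW', hb'⟩
    refine ⟨min d d', lt_min hd hd', max C C', lt_max_of_lt_left hC, W ∪ W', hW.union hW',
      Set.union_subset_union hTW hTW', ?_⟩
    rintro w (hw | hw) ε hε
    · refine (measure_mono ?_).trans ((hb w hw ε hε).trans (ENNReal.ofReal_le_ofReal ?_))
      · exact fun t ht => ⟨ht.1.trans (min_le_left _ _), ht.2⟩
      · gcongr; exact le_max_left _ _
    · refine (measure_mono ?_).trans ((hb' w hw ε hε).trans (ENNReal.ofReal_le_ofReal ?_))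
      · exact fun t ht => ⟨ht.1.trans (min_le_right _ _), ht.2⟩
      · gcongr; exact le_max_right _ _
  · intro θ hθ
    obtain ⟨m, hm, hne⟩ := h θ hθ
    have hcont : Continuous (pd^[m] Ψ) :=
      (pd_iter_contDiff (n := 0) m (hΨ.of_le (by exact_mod_cast (by omega : 0 + m ≤ N)))).continuous
    set c := |pd^[m] Ψ (0, θ)| / 2 with hc
    have hcpos : 0 < c := by positivity
    have hev : ∀ᶠ z in 𝓝 ((0 : ℝ), θ), c < |pd^[m] Ψ z| :=
      hcont.abs.continuousAt.eventually (lt_mem_nhds (by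
        have : 0 < |pd^[m] Ψ (0, θ)| := by positivity
        linarith))
    rw [nhds_prod_eq, Filter.eventually_prod_iff] at hev
    obtain ⟨pa, hpa, pb, hpb, hab⟩ := hev
    obtain ⟨d, hd, hdb⟩ := Metric.nhds_basis_closedBall.eventually_iff.1 hpa
    obtain ⟨W, hWs, hWo, hθW⟩ := eventually_nhds_iff.1 hpb
    refine ⟨W, mem_nhdsWithin_of_mem_nhds (hWo.mem_nhds hθW), d, hd,
      (subC m + 2 * d) * (2 / c) ^ ((1 : ℝ) / n₀), ?_, W, hWo, subset_rfl, ?_⟩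
    · have := subC_nonneg m
      positivity
    intro w hw ε hε
    have hsc := subC_nonneg m
    have hn' : (n₀ : ℝ) ≠ 0 := by positivity
    set δ := (2 * ε / c) ^ ((1 : ℝ) / n₀) with hδ
    have hδpos : 0 < δ := by positivity
    have hδn : δ ^ n₀ = 2 * ε / c := by
      rw [hδ, ← Real.rpow_natCast, ← Real.rpow_mul (by positivity)]
      rw [one_div_mul_cancel hn', Real.rpow_one]
    have hfin : (subC m + 2 * d) * (2 / c) ^ ((1 : ℝ) / n₀) * ε ^ ((1 : ℝ) / n₀) =
        (subC m + 2 * d) * δ := by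
      rw [mul_assoc, ← Real.mul_rpow (by positivity) (by positivity), hδ]
      congr 2; ring
    rw [hfin]
    rcases le_or_gt (2 * ε / c) 1 with hle | hgt
    · have hδ1 : δ ≤ 1 := Real.rpow_le_one (by positivity) hle (by positivity)
      have hδm : δ ^ n₀ ≤ δ ^ m := pow_le_pow_of_le_one hδpos.le hδ1 hm
      have := sublevel m (fun i t => pd^[i] Ψ (t, w)) (Set.Icc (-d) d) c δ ε
        Set.ordConnected_Icc (Metric.isBounded_Icc _ _) hcpos hδpos.le ?_ ?_ ?_
      · refine le_trans (measure_mono ?_) (this.trans (ENNReal.ofReal_le_ofReal ?_))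
        · intro t ht
          exact ⟨abs_le.1 ht.1, ht.2⟩
        · gcongr; linarith
      · have : c * δ ^ n₀ = 2 * ε := by rw [hδn]; field_simp
        have := mul_le_mul_of_nonneg_left hδm hcpos.le
        linarith
      · intro i hi t _
        have h1 := pd_hasDerivAt (pd_iter_contDiff (n := 1) i
          (hΨ.of_le (by exact_mod_cast (by omega : 1 + i ≤ N)))) t w
        simp only [Function.iterate_succ_apply']
        exact h1
      · intro t ht
        exact (hab (hdb (by simpa [Real.closedBall_eq_Icc] using ht)) (hWs w hw)).le
    · have hδ1 : 1 ≤ δ := Real.one_le_rpow hgt.le (by positivity)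
      calc _ ≤ volume (Set.Icc (-d) d) := measure_mono fun t ht => abs_le.1 ht.1
        _ = ENNReal.ofReal (2 * d) := by rw [Real.volume_Icc]; congr 1; ring
        _ ≤ _ := ENNReal.ofReal_le_ofReal (by nlinarith)

open Topology in
theorem extend_contDiff {n : ℕ} {ψ : ℝ → ℝ} (h : ContDiffAt ℝ n ψ 0) :
    ∃ s : ℝ → ℝ, ContDiff ℝ n s ∧ s =ᶠ[𝓝 0] ψ := by
  obtain ⟨u, hu, hcu⟩ := h.contDiffOn (m := n) le_rfl (by simp)
  obtain ⟨R, hR, hRu⟩ := Metric.nhds_basis_ball.mem_iff.1 hu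
  let χ : ContDiffBump (0 : ℝ) := ⟨R / 4, R / 2, by linarith, by linarith⟩
  refine ⟨fun x => χ x * ψ x, ?_, ?_⟩
  · refine contDiff_iff_contDiffAt.2 fun x => ?_
    by_cases hx : x ∈ Metric.ball (0 : ℝ) R
    · have h1 : ContDiffAt ℝ n ψ x :=
        hcu.contDiffAt (Filter.mem_of_superset (Metric.isOpen_ball.mem_nhds hx) hRu)
      exact (χ.contDiff.contDiffAt).mul h1
    · have hx2 : x ∉ tsupport χ := by
        rw [χ.tsupport_eq]
        intro h
        apply hx
        refine Metric.mem_ball.2 (lt_of_le_of_lt (Metric.mem_closedBall.1 h) ?_)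
        show R / 2 < R
        linarith
      have : (fun x => χ x * ψ x) =ᶠ[𝓝 x] fun _ => 0 := by
        have := notMem_tsupport_iff_eventuallyEq.1 hx2
        filter_upwards [this] with y hy
        simp [hy]
      exact contDiffAt_const.congr_of_eventuallyEq this
  · filter_upwards [χ.eventuallyEq_one] with x hx
    simp [hx]

open Topology in
theorem branch_exists {n : ℕ} (hn : n ≠ 0) {E : ℝ × ℝ → ℝ} (hE : ContDiff ℝ n E) {s₀ : ℝ}
    (h0 : E (0, s₀) = 0) (h1 : fderiv ℝ E (0, s₀) (0, 1) ≠ 0) :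
    ∃ s : ℝ → ℝ, ContDiff ℝ n s ∧ s 0 = s₀ ∧ (∀ᶠ x in 𝓝 (0 : ℝ), E (x, s x) = 0) ∧
      ∀ᶠ z in 𝓝 ((0 : ℝ), s₀), E z = 0 → z.2 = s z.1 := by
  have hc : ContDiffAt ℝ n E (0, s₀) := hE.contDiffAt
  have hinv : (fderiv ℝ E (0, s₀) ∘L .inr ℝ ℝ ℝ).IsInvertible := by
    refine ⟨ContinuousLinearEquiv.unitsEquivAut ℝ (Units.mk0 _ h1), ?_⟩
    ext
    simp
  have hn' : (n : WithTop ℕ∞) ≠ 0 := by exact_mod_cast hn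
  obtain ⟨s, hs, hse⟩ := extend_contDiff (hc.contDiffAt_implicitFunction hn' hinv)
  refine ⟨s, hs, ?_, ?_, ?_⟩
  · rw [hse.self_of_nhds]
    exact hc.implicitFunction_apply_self hn' hinv
  · filter_upwards [hse, hc.eventually_apply_implicitFunction hn' hinv] with x hx hx2
    rw [hx, hx2, h0]
  · have h3 : ∀ᶠ z in 𝓝 ((0 : ℝ), s₀), s z.1 = hc.implicitFunction hn' hinv z.1 :=
      (continuous_fst.tendsto ((0 : ℝ), s₀)).eventually hse
    filter_upwards [h3, hc.eventually_apply_eq_iff_implicitFunction hn' hinv] with z hz hz2 hz3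
    rw [hz]
    exact (hz2.1 (by rw [hz3, h0])).symm


/-- blow-up data of `e` at the point `q` -/
structure Blow (e : ℝ × ℝ → ℝ) (q : ℝ × ℝ) (n μ : ℕ) (E : ℝ × ℝ → ℝ) : Prop where
  cd : ContDiff ℝ n E
  eqn : ∀ x s, e (q.1 + x, q.2 + x * s) = x ^ μ * E (x, s)
  one_le : 1 ≤ μ
  le_two : μ ≤ 2
  simple : ∀ s, E (0, s) = 0 → fderiv ℝ E (0, s) (0, 1) ≠ 0

theorem hasDerivAt_snd {E : ℝ × ℝ → ℝ} {n : ℕ} (hn : n ≠ 0) (hE : ContDiff ℝ n E) (x s : ℝ) :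
    HasDerivAt (fun s => E (x, s)) (fderiv ℝ E (x, s) (0, 1)) s := by
  have h1 : HasDerivAt (fun τ : ℝ => (x, τ)) ((0 : ℝ), (1 : ℝ)) s :=
    (hasDerivAt_const s x).prodMk (hasDerivAt_id s)
  exact (hE.contDiffAt.differentiableAt (by exact_mod_cast hn)).hasFDerivAt.comp_hasDerivAt s h1

theorem hasDerivAt_id_mul {k : ℝ → ℝ} (hk : ContinuousAt k 0) :
    HasDerivAt (fun x => x * k x) (k 0) 0 := by
  rw [hasDerivAt_iff_tendsto_slope]
  refine (hk.tendsto.mono_left nhdsWithin_le_nhds).congr' ?_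
  filter_upwards [self_mem_nhdsWithin] with x hx
  have : x ≠ 0 := hx
  simp [slope_def_field, this]

theorem fderiv_apply_mk (L : ℝ × ℝ →L[ℝ] ℝ) (a b : ℝ) :
    L (a, b) = a * L (1, 0) + b * L (0, 1) := by
  have : ((a, b) : ℝ × ℝ) = a • ((1, 0) : ℝ × ℝ) + b • ((0, 1) : ℝ × ℝ) := by simp
  rw [this, map_add, map_smul, map_smul, smul_eq_mul, smul_eq_mul]

theorem hess2_symm {e : ℝ × ℝ → ℝ} {n : ℕ} (he : ContDiff ℝ (n + 2 : ℕ) e) (q u v : ℝ × ℝ) :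
    hess2 e q u v = hess2 e q v u := by
  have hd : DifferentiableAt ℝ (fderiv ℝ e) q :=
    ((he.fderiv_right (m := (n + 1 : ℕ)) (by norm_cast)).contDiffAt).differentiableAt (by simp)
  have hu : ∀ u v, hess2 e q u v = fderiv ℝ (fderiv ℝ e) q v u := by
    intro u v
    unfold hess2
    rw [fderiv_clm_apply hd (differentiableAt_const u)]
    simp
  have hs : IsSymmSndFDerivAt ℝ e q :=
    (he.of_le (by exact_mod_cast Nat.le_add_left 2 n) : ContDiff ℝ 2 e).contDiffAt.isSymmSndFDerivAt (by simp)
  rw [hu, hu]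
  exact hs v u

theorem blow_exists {n : ℕ} (hn : n ≠ 0) {e : ℝ × ℝ → ℝ} (he : ContDiff ℝ (n + 2 : ℕ) e)
    {q : ℝ × ℝ} (hq : e q = 0)
    (hH : fderiv ℝ e q = 0 → hess2 e q (1, 0) (1, 0) * hess2 e q (0, 1) (0, 1) -
      hess2 e q (1, 0) (0, 1) * hess2 e q (0, 1) (1, 0) ≠ 0) :
    ∃ μ E, Blow e q n μ E := by
  set g : ℝ × ℝ → ℝ := fun z => e (q.1 + z.1, q.2 + z.1 * z.2) with hg
  have hgc : ContDiff ℝ (n + 2 : ℕ) g := he.comp (by fun_prop)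
  have hed : ∀ z, DifferentiableAt ℝ e z := fun z =>
      he.contDiffAt.differentiableAt (by simp)
  have hg0 : ∀ s, g (0, s) = 0 := fun s => by simp [hg, hq]
  obtain ⟨G, hGc, hGeq, hG0⟩ := hadamard_div (n + 1) g hgc
  have hpath : ∀ x s : ℝ, HasDerivAt (fun x : ℝ => (q.1 + x, q.2 + x * s)) ((1 : ℝ), s) x := by
    intro x s
    have h1 := (hasDerivAt_id x).const_add q.1
    have h2 := ((hasDerivAt_id x).mul_const s).const_add q.2
    simpa using h1.prodMk h2
  have hgx : ∀ x s, HasDerivAt (fun x => g (x, s))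
      (fderiv ℝ e (q.1 + x, q.2 + x * s) (1, s)) x := fun x s =>
    (hed _).hasFDerivAt.comp_hasDerivAt x (hpath x s)
  have hg1 : ContDiff ℝ 1 g := hgc.of_le (by exact_mod_cast (by omega : 1 ≤ n + 2))
  have hG0' : ∀ s, G (0, s) = fderiv ℝ e q (1, s) := by
    intro s
    rw [hG0]
    have := (pd_hasDerivAt hg1 0 s).unique (hgx 0 s)
    simpa [pd] using this
  by_cases hsing : fderiv ℝ e q = 0
  · obtain ⟨E, hEc, hEeq, hE0⟩ := hadamard_div n G hGc
    have hEe : ∀ x s, g (x, s) = x ^ 2 * E (x, s) := by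
      intro x s
      have h1 := hGeq x s
      have h2 := hEeq x s
      rw [hG0', hsing] at h2
      simp only [zero_apply, sub_zero] at h2
      rw [hg0, h2] at h1
      linarith
    set h11 := hess2 e q (1, 0) (1, 0)
    set h12 := hess2 e q (1, 0) (0, 1)
    set h21 := hess2 e q (0, 1) (1, 0)
    set h22 := hess2 e q (0, 1) (0, 1)
    have hsym : h12 = h21 := hess2_symm he q _ _
    have hE1 : ContDiff ℝ 1 E := hEc.of_le (by exact_mod_cast (by omega : 1 ≤ n))
    have hval : ∀ s, E (0, s) = (h11 + 2 * h12 * s + h22 * s ^ 2) / 2 := by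
      intro s
      have hA : HasDerivAt (fun x : ℝ => fderiv ℝ e (q.1 + x, q.2 + x * s) (1, s))
          (h11 + s * h12 + s * (h21 + s * h22)) 0 := by
        have hu : ∀ u, HasDerivAt (fun x : ℝ => fderiv ℝ e (q.1 + x, q.2 + x * s) u)
            (hess2 e q u (1, s)) 0 := by
          intro u
          have hd : ContDiff ℝ (n + 1 : ℕ) (fun z => fderiv ℝ e z u) := by
            have := he.fderiv_right (m := (n + 1 : ℕ)) (by norm_cast)
            fun_prop
          have := ((hd.contDiffAt (x := (q.1 + 0, q.2 + 0 * s))).differentiableAt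
            (by simp)).hasFDerivAt.comp_hasDerivAt (0 : ℝ) (hpath 0 s)
          simpa [hess2, Function.comp_def] using this
        have h1 := (hu (1, 0)).add ((hu (0, 1)).const_mul s)
        refine (h1.congr_deriv ?_).congr_of_eventuallyEq ?_
        · simp only [hess2]
          rw [fderiv_apply_mk _ 1 s, fderiv_apply_mk _ 1 s]
          simp only [h11, h12, h21, h22, hess2]
          ring
        · refine Filter.Eventually.of_forall fun x => ?_
          simp only [Pi.add_apply]
          rw [fderiv_apply_mk _ 1 s, one_mul]
      have hB : (fun x : ℝ => fderiv ℝ e (q.1 + x, q.2 + x * s) (1, s)) =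
          fun x => x * (2 * E (x, s) + x * pd E (x, s)) := by
        funext x
        refine (hgx x s).unique ?_
        have h1 := ((hasDerivAt_id x).pow 2).mul (pd_hasDerivAt hE1 x s)
        have h2 : (fun x => g (x, s)) = fun x => x ^ 2 * E (x, s) := funext fun x => hEe x s
        rw [h2]
        refine h1.congr_deriv ?_
        simp; ring
      rw [hB] at hA
      have hc1 := hEc.continuous
      have hc2 : Continuous (pd E) := (pd_contDiff (n := 0) (by simpa using hE1)).continuous
      have := hA.unique (hasDerivAt_id_mul (k := fun x => 2 * E (x, s) + x * pd E (x, s))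
        (Continuous.continuousAt (by fun_prop)))
      simp only [zero_mul, add_zero] at this
      rw [← hsym] at this
      linarith
    refine ⟨2, E, hEc, hEe, by norm_num, le_rfl, ?_⟩
    intro s hs hs'
    have hD := hasDerivAt_snd hn hEc 0 s
    rw [hs'] at hD
    have hD2 : HasDerivAt (fun s => E (0, s)) (h12 + h22 * s) s := by
      have h2 : (fun s => E (0, s)) = fun s => (h11 + 2 * h12 * s + h22 * s ^ 2) / 2 := funext hval
      rw [h2]
      have h3 := ((((hasDerivAt_id s).const_mul (2 * h12)).const_add h11).add
        (((hasDerivAt_id s).pow 2).const_mul h22)).div_const 2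
      refine h3.congr_deriv ?_
      simp; ring
    have h4 := hD.unique hD2
    rw [hval] at hs
    refine hH hsing ?_
    rw [← hsym]
    have h5 : h11 + h12 * s = 0 := by linear_combination 2 * hs + s * h4
    linear_combination h22 * h5 + h12 * h4
  · refine ⟨1, G, hGc.of_le (by exact_mod_cast Nat.le_succ n), ?_, le_rfl, by norm_num, ?_⟩
    · intro x s
      have := hGeq x s
      rw [hg0] at this
      simpa [hg] using this
    · intro s hs hs'
      have hD := hasDerivAt_snd (Nat.succ_ne_zero n) hGc 0 s
      rw [hs'] at hD
      have hD2 : HasDerivAt (fun s => G (0, s)) (fderiv ℝ e q (0, 1)) s := by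
        have h2 : (fun s => G (0, s)) = fun s => fderiv ℝ e q (1, 0) + s * fderiv ℝ e q (0, 1) := by
          funext s; rw [hG0', fderiv_apply_mk _ 1 s]; simp
        rw [h2]
        simpa using ((hasDerivAt_id s).mul_const (fderiv ℝ e q (0, 1))).const_add (fderiv ℝ e q (1, 0))
      have h4 := hD.unique hD2
      rw [hG0', fderiv_apply_mk _ 1 s] at hs
      apply hsing
      refine ContinuousLinearMap.ext fun v => ?_
      rw [← Prod.mk.eta (p := v), fderiv_apply_mk]
      have h6 : fderiv ℝ e q (1, 0) = 0 := by linear_combination hs + s * h4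
      rw [h6, ← h4]; simp

theorem Blow.neg {e : ℝ × ℝ → ℝ} {q : ℝ × ℝ} {n μ : ℕ} {E : ℝ × ℝ → ℝ} (hn : n ≠ 0)
    (h : Blow e q n μ E) :
    Blow (fun k => e (-k)) (-q) n μ (fun z => (-1) ^ μ * E (-z.1, z.2)) := by
  have hc := h.cd
  have hcd : ContDiff ℝ n (fun z : ℝ × ℝ => (-1) ^ μ * E (-z.1, z.2)) :=
    contDiff_const.mul (hc.comp (by fun_prop))
  refine ⟨hcd, ?_, h.one_le, h.le_two, ?_⟩
  · intro x s
    have := h.eqn (-x) s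
    rw [neg_pow] at this
    simp only [Prod.neg_mk, Prod.fst_neg, Prod.snd_neg, neg_add_rev, neg_neg]
    rw [← mul_assoc, mul_comm (x ^ μ), ← this]
    congr 2 <;> ring
  · intro s hs hs'
    simp only [neg_zero] at hs
    have hs0 : E (0, s) = 0 := by simpa using hs
    have hD := hasDerivAt_snd hn hcd 0 s
    rw [hs'] at hD
    simp only [neg_zero] at hD
    have := hD.unique ((hasDerivAt_snd hn hc 0 s).const_mul ((-1) ^ μ))
    exact h.simple s hs0 (by simpa using this.symm)


open Topology in
theorem isLittleO_of_punctured {φ ψ : ℝ → ℝ} (h : φ =o[𝓝[≠] 0] ψ) (h0 : φ 0 = 0) :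
    φ =o[𝓝 0] ψ := by
  rw [Asymptotics.isLittleO_iff] at h ⊢
  intro c hc
  have := eventually_nhdsWithin_iff.1 (h hc)
  filter_upwards [this] with x hx
  by_cases hx0 : x = 0
  · subst hx0
    rw [h0, norm_zero]; positivity
  · exact hx hx0

open Topology in
theorem isLittleO_div_pow {φ : ℝ → ℝ} {a b : ℕ} 
    (h : (fun t => t ^ a * φ t) =o[𝓝[≠] 0] fun t : ℝ => t ^ (a + b)) :
    φ =o[𝓝[≠] 0] fun t : ℝ => t ^ b := by
  have h1 := (Asymptotics.isBigO_refl (fun t : ℝ => (t ^ a)⁻¹) (𝓝[≠] 0)).mul_isLittleO h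
  refine h1.congr' ?_ ?_
  · filter_upwards [self_mem_nhdsWithin] with t ht
    have : t ≠ 0 := ht
    field_simp
  · filter_upwards [self_mem_nhdsWithin] with t ht
    have : t ≠ 0 := ht
    rw [pow_add]
    field_simp

open Topology in
theorem isLittleO_weaken {φ : ℝ → ℝ} {a b : ℕ} {l : Filter ℝ} (hl : l ≤ 𝓝 0) (hab : a ≤ b)
    (h : φ =o[l] fun t : ℝ => t ^ b) : φ =o[l] fun t : ℝ => t ^ a := by
  refine h.trans_isBigO (Asymptotics.IsBigO.mono ?_ hl)
  have : (fun t : ℝ => t ^ b) = fun t => t ^ a * t ^ (b - a) := by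
    funext t; rw [← pow_add]; congr 1; omega
  rw [this]
  have hb : (fun t : ℝ => t ^ (b - a)) =O[nhds 0] fun _ => (1 : ℝ) :=
    (continuous_pow (b - a)).continuousAt.norm.isBoundedUnder_le.isBigO_one ℝ
  simpa using (Asymptotics.isBigO_refl (fun t : ℝ => t ^ a) (nhds 0)).mul hb

open Topology in
theorem eq_zero_of_isLittleO {φ : ℝ → ℝ} {b : ℕ} (hφ : ContinuousAt φ 0)
    (h : φ =o[𝓝[≠] 0] fun t : ℝ => t ^ b) : φ 0 = 0 := by
  have h1 : φ =o[𝓝[≠] 0] fun t : ℝ => (1 : ℝ) := by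
    simpa using isLittleO_weaken (a := 0) nhdsWithin_le_nhds (Nat.zero_le b) h
  exact tendsto_nhds_unique (hφ.tendsto.mono_left nhdsWithin_le_nhds)
    ((Asymptotics.isLittleO_one_iff ℝ).1 h1)

/-- one half of the no-nesting condition -/
def NestX (e₁ e₂ : ℝ × ℝ → ℝ) (n n₀ : ℕ) (kt pt : ℝ × ℝ) : Prop :=
  (∀ U ∈ nhds (0 : ℝ), ∀ f g : ℝ → ℝ,
    ContDiffOn ℝ n f U → ContDiffOn ℝ n g U → f 0 = 0 → g 0 = 0 →
    (∀ t ∈ U, e₁ (kt.1 + t, kt.2 + f t) = 0) →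
    (∀ t ∈ U, e₂ (pt.1 + t, pt.2 + g t) = 0) →
    ∃ m : ℕ, m ≤ n₀ - 1 ∧ iteratedDerivWithin m (fun t => f t - g t) U 0 ≠ 0)

/-- one half of the nonflatness condition -/
def FlatX (e : ℝ × ℝ → ℝ) (n n₀ : ℕ) (kt : ℝ × ℝ) : Prop :=
  (∀ U ∈ nhds (0 : ℝ), ∀ f : ℝ → ℝ, ContDiffOn ℝ n f U → f 0 = 0 →
      (∀ t ∈ U, e (kt.1 + t, kt.2 + f t) = 0) →
      ∃ m : ℕ, 2 ≤ m ∧ m ≤ n₀ - 1 ∧ iteratedDerivWithin m f U 0 ≠ 0)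

open Topology in
theorem order_nonnest {n n₀ : ℕ} (hn₀ : 3 ≤ n₀) (hn : n₀ ≤ n) {e₁ e₂ : ℝ × ℝ → ℝ}
    (he₂ : ContDiff ℝ n e₂) {kt q : ℝ × ℝ} {μ : ℕ} {E : ℝ × ℝ → ℝ} (hB : Blow e₂ q n μ E)
    (hN : NestX e₁ e₂ n n₀ kt q) {s : ℝ → ℝ} (hs : ContDiff ℝ n s)
    (hbr : ∀ᶠ t in 𝓝 (0 : ℝ), e₁ (kt.1 + t, kt.2 + t * s t) = 0) :
    ∃ m ≤ n₀, iteratedDeriv m (fun t => e₂ (q.1 + t, q.2 + t * s t)) 0 ≠ 0 := by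
  by_contra! hcon
  have hn0 : n ≠ 0 := by omega
  have hEc := hB.cd
  have hsc := hs.continuous
  have hhc : ContDiff ℝ n (fun t => e₂ (q.1 + t, q.2 + t * s t)) := he₂.comp (by fun_prop)
  have ho := isLittleO_of_derivs (hhc.of_le (by exact_mod_cast hn)) hcon
  have h1 := hB.one_le
  have h2 := hB.le_two
  have ho1 : (fun t => E (t, s t)) =o[𝓝[≠] 0] fun t : ℝ => t ^ (n₀ - μ) := by
    refine isLittleO_div_pow (a := μ) ?_
    rw [show μ + (n₀ - μ) = n₀ by omega]
    refine (ho.mono nhdsWithin_le_nhds).congr_left fun t => ?_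
    exact hB.eqn t (s t)
  have hcont : Continuous (fun t => E (t, s t)) := hEc.continuous.comp (by fun_prop)
  have hE0 : E (0, s 0) = 0 := eq_zero_of_isLittleO hcont.continuousAt ho1
  have hd0 := hB.simple _ hE0
  obtain ⟨s2, hs2, hs20, hs2E, -⟩ := branch_exists hn0 hEc hE0 hd0
  set c := fderiv ℝ E (0, s 0) (0, 1) with hc
  have hstrict := (hEc.contDiffAt (x := ((0 : ℝ), s 0))).hasStrictFDerivAt
    (by exact_mod_cast hn0)
  have htend : Filter.Tendsto (fun t => ((t, s t), (t, s2 t))) (𝓝 0)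
      (𝓝 (((0 : ℝ), s 0), ((0 : ℝ), s 0))) := by
    have hs2c := hs2.continuous
    have : Continuous (fun t => ((t, s t), (t, s2 t))) := by fun_prop
    have := this.tendsto 0
    simpa [hs20] using this
  have hO : (fun t => s t - s2 t) =O[𝓝 0] fun t => E (t, s t) := by
    have h3 := hstrict.isLittleO.comp_tendsto htend
    have h4 := (Asymptotics.isLittleO_iff.1 h3) (c := |c| / 2) (by positivity)
    refine Asymptotics.IsBigO.of_bound (2 / |c|) ?_
    filter_upwards [h4, hs2E] with t ht ht2
    simp only [Function.comp, ht2, sub_zero, Prod.mk_sub_mk, sub_self] at ht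
    rw [fderiv_apply_mk, ← hc, zero_mul, zero_add, Prod.norm_mk, norm_zero,
      max_eq_right (norm_nonneg _)] at ht
    simp only [Real.norm_eq_abs] at ht ⊢
    have h5 : |(s t - s2 t) * c| ≤ |E (t, s t)| + |c| / 2 * |s t - s2 t| := by
      have := abs_sub_abs_le_abs_sub ((s t - s2 t) * c) (E (t, s t))
      rw [abs_sub_comm] at this
      linarith
    rw [abs_mul] at h5
    have hcp : 0 < |c| := by positivity
    rw [div_mul_eq_mul_div, le_div_iff₀ hcp]
    linarith
  have ho2 : (fun t => t * s t - t * s2 t) =o[𝓝[≠] 0] fun t : ℝ => t ^ (n₀ - 1) := by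
    have h5 := (hO.mono nhdsWithin_le_nhds).trans_isLittleO ho1
    have h6 := (Asymptotics.isBigO_refl (fun t : ℝ => t) (𝓝[≠] 0)).mul_isLittleO h5
    refine isLittleO_weaken (b := n₀ - μ + 1) nhdsWithin_le_nhds (by omega) ?_
    refine h6.congr ?_ ?_
    · intro t; ring
    · intro t; ring
  have ho3 := isLittleO_of_punctured ho2 (by simp)
  have hfgc : ContDiff ℝ n (fun t => t * s t - t * s2 t) := by fun_prop
  have hder := derivs_of_isLittleO (hfgc.of_le (by exact_mod_cast (by omega : n₀ - 1 ≤ n))) ho3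
  obtain ⟨U, hU, hUo, hU0⟩ := eventually_nhds_iff.1 (hbr.and hs2E)
  obtain ⟨m, hm, hne⟩ := hN U (hUo.mem_nhds hU0) (fun t => t * s t) (fun t => t * s2 t)
    (by fun_prop) (by fun_prop) (by simp) (by simp) (fun t ht => (hU t ht).1)
    (fun t ht => by rw [hB.eqn, (hU t ht).2, mul_zero])
  rw [iteratedDerivWithin_of_isOpen hUo hU0] at hne
  exact hne (hder m hm)

open Topology in
theorem order_nest {n n₀ : ℕ} (hn₀ : 3 ≤ n₀) (hn : n₀ ≤ n) {e : ℝ × ℝ → ℝ}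
    (he : ContDiff ℝ (n + 2 : ℕ) e) {kt : ℝ × ℝ} {μ : ℕ} {E : ℝ × ℝ → ℝ} (hB : Blow e kt n μ E)
    (hF : FlatX e n n₀ kt) {s : ℝ → ℝ} (hs : ContDiff ℝ n s)
    (hbr : ∀ᶠ t in 𝓝 (0 : ℝ), E (t, s t) = 0) (θ : ℝ × ℝ) (hθ : θ ≠ 0) :
    ∃ m ≤ n₀, iteratedDeriv m (fun t => fderiv ℝ e (kt.1 + t, kt.2 + t * s t) θ) 0 ≠ 0 := by
  by_contra! hcon
  have hn0 : n ≠ 0 := by omega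
  have hEc := hB.cd
  have hsc := hs.continuous
  have hfc : ContDiff ℝ n (fun t => t * s t) := by fun_prop
  have hed : ∀ z, DifferentiableAt ℝ e z := fun z =>
      he.contDiffAt.differentiableAt (by simp)
  have hfd : ContDiff ℝ n (fun z : ℝ × ℝ => fderiv ℝ e z θ) := by
    have := he.fderiv_right (m := n) (by norm_cast; omega)
    fun_prop
  have hhc : ContDiff ℝ n (fun t => fderiv ℝ e (kt.1 + t, kt.2 + t * s t) θ) :=
    hfd.comp (f := fun t => (kt.1 + t, kt.2 + t * s t)) (by fun_prop)
  have ho := isLittleO_of_derivs (hhc.of_le (by exact_mod_cast hn)) hcon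
  have h1 := hB.one_le
  have h2 := hB.le_two
  have hE0 : E (0, s 0) = 0 := hbr.self_of_nhds
  have hd0 := hB.simple _ hE0
  set f := fun t => t * s t with hf
  set Es := fun t => fderiv ℝ E (t, s t) (0, 1) with hEs
  have hEsc : Continuous Es := by
    have h3 : ContDiff ℝ 0 (fun z : ℝ × ℝ => fderiv ℝ E z (0, 1)) := by
      have := hEc.fderiv_right (m := 0) (by exact_mod_cast (by omega : 0 + 1 ≤ n))
      fun_prop
    exact h3.continuous.comp (f := fun t => (t, s t)) (by fun_prop)
  -- derivative in y
  have hy : ∀ t, t * fderiv ℝ e (kt.1 + t, kt.2 + t * s t) (0, 1) = t ^ μ * Es t := by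
    intro t
    have hA : HasDerivAt (fun y : ℝ => e (kt.1 + t, kt.2 + t * y))
        (fderiv ℝ e (kt.1 + t, kt.2 + t * s t) (0, t)) (s t) := by
      have hp : HasDerivAt (fun y : ℝ => (kt.1 + t, kt.2 + t * y)) ((0 : ℝ), t) (s t) := by
        have := ((hasDerivAt_id (s t)).const_mul t).const_add kt.2
        simpa using (hasDerivAt_const (s t) (kt.1 + t)).prodMk this
      exact (hed _).hasFDerivAt.comp_hasDerivAt (s t) hp
    have hC := (hasDerivAt_snd hn0 hEc t (s t)).const_mul (t ^ μ)
    have : (fun y : ℝ => e (kt.1 + t, kt.2 + t * y)) = fun y => t ^ μ * E (t, y) :=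
      funext fun y => hB.eqn t y
    rw [this] at hA
    have h3 := hA.unique hC
    rw [fderiv_apply_mk] at h3
    linarith
  have hfdiff : ∀ t, HasDerivAt f (deriv f t) t := fun t =>
    (hfc.contDiffAt.differentiableAt (by exact_mod_cast hn0)).hasDerivAt
  have hx : ∀ᶠ t in 𝓝 (0 : ℝ), fderiv ℝ e (kt.1 + t, kt.2 + t * s t) (1, deriv f t) = 0 := by
    filter_upwards [hbr.eventually_nhds] with t ht
    have hp : HasDerivAt (fun t : ℝ => (kt.1 + t, kt.2 + f t)) ((1 : ℝ), deriv f t) t :=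
      ((hasDerivAt_id t).const_add kt.1).prodMk ((hfdiff t).const_add kt.2)
    have hA := (hed (kt.1 + t, kt.2 + f t)).hasFDerivAt.comp_hasDerivAt t hp
    have hz : (e ∘ fun t : ℝ => (kt.1 + t, kt.2 + f t)) =ᶠ[𝓝 t] fun _ => 0 := by
      filter_upwards [ht] with y hy
      simp only [Function.comp, hf, hB.eqn, hy, mul_zero]
    exact hA.unique ((hasDerivAt_const t (0 : ℝ)).congr_of_eventuallyEq hz)
  set w := fun t => θ.2 - θ.1 * deriv f t with hw
  have hdfc : ContDiff ℝ (n - 1 : ℕ) (deriv f) := by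
    have : ContDiff ℝ ((n - 1 : ℕ) + 1) f := by
      have h3 : ((n - 1 : ℕ) : WithTop ℕ∞) + 1 = (n : ℕ) := by
        exact_mod_cast (by omega : n - 1 + 1 = n)
      rw [h3]; exact hfc
    exact (contDiff_succ_iff_deriv.1 this).2.2
  have hwc : ContDiff ℝ (n - 1 : ℕ) w := contDiff_const.sub (contDiff_const.mul hdfc)
  have hkey : ∀ᶠ t in 𝓝 (0 : ℝ), t ^ μ * w t =
      (t * fderiv ℝ e (kt.1 + t, kt.2 + t * s t) θ) * (Es t)⁻¹ := by
    have hne : ∀ᶠ t in 𝓝 (0 : ℝ), Es t ≠ 0 := hEsc.continuousAt.eventually_ne hd0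
    filter_upwards [hne, hx] with t ht hxt
    rw [eq_mul_inv_iff_mul_eq₀ ht]
    rw [fderiv_apply_mk] at hxt
    rw [← Prod.mk.eta (p := θ), fderiv_apply_mk]
    have := hy t
    simp only [hw]
    linear_combination -(θ.2 - θ.1 * deriv f t) * this - t * θ.1 * hxt
  have hbd : (fun t => (Es t)⁻¹) =O[𝓝[≠] 0] fun _ => (1 : ℝ) :=
    ((hEsc.continuousAt.inv₀ hd0).norm.isBoundedUnder_le.isBigO_one ℝ).mono nhdsWithin_le_nhds
  have hwo : w =o[𝓝[≠] 0] fun t : ℝ => t ^ (n₀ + 1 - μ) := by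
    refine isLittleO_div_pow (a := μ) ?_
    rw [show μ + (n₀ + 1 - μ) = 1 + n₀ by omega]
    have h3 := (Asymptotics.isBigO_refl (fun t : ℝ => t) (𝓝[≠] 0)).mul_isLittleO
      (ho.mono nhdsWithin_le_nhds)
    have h4 := h3.mul_isBigO hbd
    refine h4.congr' ?_ ?_
    · filter_upwards [hkey.filter_mono nhdsWithin_le_nhds] with t ht
      rw [ht]
    · filter_upwards with t
      ring
  have hw0 : w 0 = 0 := eq_zero_of_isLittleO hwc.continuous.continuousAt hwo
  have hwo2 := isLittleO_weaken (a := n₀ - 2) le_rfl (by omega) (isLittleO_of_punctured hwo hw0)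
  have hder := derivs_of_isLittleO (hwc.of_le (by exact_mod_cast (by omega : n₀ - 2 ≤ n - 1))) hwo2
  have hθ1 : θ.1 ≠ 0 := by
    intro h
    apply hθ
    simp only [hw, h, zero_mul, sub_zero] at hw0
    exact Prod.ext h hw0
  obtain ⟨U, hU, hUo, hU0⟩ := eventually_nhds_iff.1 hbr
  obtain ⟨m, hm2, hm, hne⟩ := hF U (hUo.mem_nhds hU0) f hfc.contDiffOn (by simp [hf])
    (fun t ht => by rw [hf, hB.eqn, hU t ht, mul_zero])
  rw [iteratedDerivWithin_of_isOpen hUo hU0] at hne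
  obtain ⟨i, rfl⟩ : ∃ i, m = i + 1 := ⟨m - 1, by omega⟩
  have h5 := hder i (by omega)
  rw [hw, iteratedDeriv_const_sub (by omega)] at h5
  rw [iteratedDeriv_succ'] at hne
  apply hne
  have h6 : iteratedDeriv i (fun t => θ.1 * deriv f t) 0 = θ.1 * iteratedDeriv i (deriv f) 0 := by
    rw [iteratedDeriv_const_mul_field]
  rw [iteratedDeriv_neg, h6] at h5
  simpa [hθ1] using h5


/-- sublevel volume bound along a curve -/
def VB (e : ℝ × ℝ → ℝ) (n₀ : ℕ) (σ : ℝ) (pt kt : ℝ × ℝ) (s : ℝ → ℝ) : Prop :=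
  ∃ d > 0, ∃ C > 0, ∀ ε > 0, ∀ p : ℝ × ℝ, 0 < ‖p - pt‖ → ‖p - pt‖ ≤ d →
    volume {t : ℝ | |t| ≤ d ∧ |e (p + σ • ((kt.1 + t, kt.2 + t * s t) : ℝ × ℝ))| ≤ ε} ≤
      ENNReal.ofReal (C * (ε / ‖p - pt‖) ^ ((1 : ℝ) / n₀))

open Topology in
theorem vb_nonnest {n n₀ : ℕ} (hn₀ : 0 < n₀) (hn : n₀ ≤ n) {e : ℝ × ℝ → ℝ}
    (he : ContDiff ℝ n e) (σ : ℝ) (pt kt : ℝ × ℝ) {s : ℝ → ℝ} (hs : ContDiff ℝ n s)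
    (h : ∃ m ≤ n₀, iteratedDeriv m
      (fun t => e (pt + σ • ((kt.1 + t, kt.2 + t * s t) : ℝ × ℝ))) 0 ≠ 0) :
    VB e n₀ σ pt kt s := by
  set Ψ : ℝ × (ℝ × ℝ) → ℝ :=
    fun z => e (z.2 + σ • ((kt.1 + z.1, kt.2 + z.1 * s z.1) : ℝ × ℝ)) with hΨ
  have hΨc : ContDiff ℝ n Ψ := he.comp (by fun_prop)
  obtain ⟨d, hd, C, hC, W, hW, hKW, hb⟩ := core_sublevel n₀ n hn₀ hn Ψ hΨc {pt}
    isCompact_singleton (by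
      rintro θ rfl
      obtain ⟨m, hm, hne⟩ := h
      refine ⟨m, hm, ?_⟩
      have := congrFun (pd_iter_eq hΨc θ m (hm.trans hn)) 0
      rw [← this]
      exact hne)
  obtain ⟨ρ, hρ, hρW⟩ := Metric.nhds_basis_closedBall.mem_iff.1
    (hW.mem_nhds (hKW (Set.mem_singleton pt)))
  refine ⟨min d (min ρ 1), by positivity, C, hC, ?_⟩
  intro ε hε p hp0 hp
  have hp1 : ‖p - pt‖ ≤ 1 := hp.trans ((min_le_right _ _).trans (min_le_right _ _))
  have hpρ : ‖p - pt‖ ≤ ρ := hp.trans ((min_le_right _ _).trans (min_le_left _ _))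
  have hpW : p ∈ W := hρW (by rwa [Metric.mem_closedBall, dist_eq_norm])
  refine (measure_mono ?_).trans ((hb p hpW ε hε).trans (ENNReal.ofReal_le_ofReal ?_))
  · exact fun t ht => ⟨ht.1.trans (min_le_left _ _), ht.2⟩
  · gcongr
    rw [le_div_iff₀ hp0]
    nlinarith

open Topology in
theorem vb_nest {n n₀ : ℕ} (hn₀ : 0 < n₀) (hn : n₀ ≤ n) {e : ℝ × ℝ → ℝ}
    (he : ContDiff ℝ (n + 1 : ℕ) e) (kt : ℝ × ℝ) {s : ℝ → ℝ} (hs : ContDiff ℝ (n + 1 : ℕ) s)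
    (hz : ∀ᶠ t in 𝓝 (0 : ℝ), e (kt.1 + t, kt.2 + t * s t) = 0)
    (h : ∀ θ : ℝ × ℝ, θ ≠ 0 → ∃ m ≤ n₀, iteratedDeriv m
      (fun t => fderiv ℝ e (kt.1 + t, kt.2 + t * s t) θ) 0 ≠ 0) :
    VB e n₀ 1 0 kt s := by
  set g : ℝ × (ℝ × (ℝ × ℝ)) → ℝ :=
    fun z => e (((kt.1 + z.2.1, kt.2 + z.2.1 * s z.2.1) : ℝ × ℝ) + z.1 • z.2.2) with hg
  have hgc : ContDiff ℝ (n + 1 : ℕ) g := he.comp (by fun_prop)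
  obtain ⟨G, hGc, hGeq, hG0⟩ := hadamard_div n g hgc
  set Ψ : ℝ × (ℝ × (ℝ × ℝ)) → ℝ := fun z => G (z.2.1, (z.1, z.2.2)) with hΨ
  have hΨc : ContDiff ℝ n Ψ := hGc.comp (by fun_prop)
  have hΨ0 : ∀ θ, (fun t => Ψ (t, (0, θ))) =
      fun t => fderiv ℝ e (kt.1 + t, kt.2 + t * s t) θ := by
    intro θ
    funext t
    simp only [hΨ, hG0]
    have h1 := pd_hasDerivAt (hgc.of_le (by exact_mod_cast (by omega : 1 ≤ n + 1))) 0 (t, θ)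
    have hp : HasDerivAt (fun u : ℝ => ((kt.1 + t, kt.2 + t * s t) : ℝ × ℝ) + u • θ) θ 0 := by
      simpa using ((hasDerivAt_id (0 : ℝ)).smul_const θ).const_add
        ((kt.1 + t, kt.2 + t * s t) : ℝ × ℝ)
    have h2 := (he.contDiffAt.differentiableAt (by simp) :
      DifferentiableAt ℝ e (((kt.1 + t, kt.2 + t * s t) : ℝ × ℝ) + (0 : ℝ) • θ)).hasFDerivAt.comp_hasDerivAt 0 hp
    have h3 := h1.unique h2
    simpa [pd] using h3
  have hK : IsCompact (({0} : Set ℝ) ×ˢ Metric.sphere (0 : ℝ × ℝ) 1) :=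
    isCompact_singleton.prod (isCompact_sphere _ _)
  obtain ⟨d, hd, C, hC, W, hW, hKW, hb⟩ := core_sublevel n₀ n hn₀ hn Ψ hΨc _ hK (by
      rintro ⟨u, θ⟩ ⟨hu, hθ⟩
      obtain rfl : u = 0 := hu
      have hθ0 : θ ≠ 0 := by
        rintro rfl
        simp at hθ
      obtain ⟨m, hm, hne⟩ := h θ hθ0
      refine ⟨m, hm, ?_⟩
      have := congrFun (pd_iter_eq hΨc (0, θ) m (hm.trans hn)) 0
      rw [← this, hΨ0]
      exact hne)
  obtain ⟨A, B, hA, hBo, h0A, hSB, hAB⟩ := generalized_tube_lemma isCompact_singleton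
    (isCompact_sphere (0 : ℝ × ℝ) 1) hW hKW
  obtain ⟨ρ, hρ, hρA⟩ := Metric.nhds_basis_closedBall.mem_iff.1
    (hA.mem_nhds (h0A (Set.mem_singleton 0)))
  obtain ⟨τ, hτ, hτz⟩ := Metric.nhds_basis_closedBall.eventually_iff.1 hz
  refine ⟨min d (min ρ τ), by positivity, C, hC, ?_⟩
  intro ε hε p hp0 hp
  rw [sub_zero] at *
  have hpρ : ‖p‖ ≤ ρ := hp.trans ((min_le_right _ _).trans (min_le_left _ _))
  have hw : (‖p‖, ‖p‖⁻¹ • p) ∈ W := by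
    refine hAB ⟨hρA ?_, hSB ?_⟩
    · simpa using hpρ
    · simp [norm_smul, hp0.ne']
  refine (measure_mono ?_).trans (hb _ hw (ε / ‖p‖) (by positivity))
  intro t ht
  refine ⟨ht.1.trans (min_le_left _ _), ?_⟩
  have ht0 : e (kt.1 + t, kt.2 + t * s t) = 0 := hτz (by
    have := ht.1.trans ((min_le_right _ _).trans (min_le_right _ _))
    simpa using this)
  have h4 := hGeq ‖p‖ (t, ‖p‖⁻¹ • p)
  simp only [hg, zero_mul, zero_smul, add_zero, ht0, sub_zero, smul_smul, mul_inv_cancel₀ hp0.ne', one_smul]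
    at h4
  have h5 := ht.2
  rw [one_smul, add_comm, h4, abs_mul, abs_norm] at h5
  rw [le_div_iff₀ hp0, mul_comm]
  exact h5

/-- the local bound over the slopes in `T` -/
def Good (e : ℝ × ℝ → ℝ) (n₀ : ℕ) (σ : ℝ) (pt kt : ℝ × ℝ) (T : Set ℝ) : Prop :=
  ∃ d > 0, ∃ D > 0, ∀ ε > 0, ∀ p : ℝ × ℝ, 0 < ‖p - pt‖ → ‖p - pt‖ ≤ d →
    μH[1] {k : ℝ × ℝ | e k = 0 ∧ ‖k - kt‖ ≤ d ∧ |e (p + σ • k)| ≤ ε ∧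
      ∃ x s : ℝ, x ≠ 0 ∧ s ∈ T ∧ k = (kt.1 + x, kt.2 + x * s)} ≤
      ENNReal.ofReal (D * (ε / ‖p - pt‖) ^ ((1 : ℝ) / n₀))

open Topology in
theorem good_local {n n₀ : ℕ} (hn : n ≠ 0) {e : ℝ × ℝ → ℝ} (σ : ℝ) (pt kt : ℝ × ℝ)
    {μ : ℕ} {E : ℝ × ℝ → ℝ} (hB : Blow e kt n μ E)
    (hV : ∀ s : ℝ → ℝ, ContDiff ℝ n s → (∀ᶠ t in 𝓝 (0 : ℝ), E (t, s t) = 0) →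
      VB e n₀ σ pt kt s) (s₀ : ℝ) :
    ∃ T ∈ 𝓝 s₀, Good e n₀ σ pt kt T := by
  have hxle : ∀ k : ℝ × ℝ, ∀ x y d : ℝ, k = (kt.1 + x, kt.2 + y) → ‖k - kt‖ ≤ d → |x| ≤ d := by
    rintro k x y d rfl hk
    have := (norm_fst_le _).trans hk
    simpa using this
  by_cases h0 : E (0, s₀) = 0
  · obtain ⟨s, hs, hs0, hsE, huniq⟩ := branch_exists hn hB.cd h0 (hB.simple s₀ h0)
    obtain ⟨d, hd, C, hC, hb⟩ := hV s hs hsE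
    rw [nhds_prod_eq, Filter.eventually_prod_iff] at huniq
    obtain ⟨pa, hpa, pb, hpb, hab⟩ := huniq
    obtain ⟨d1, hd1, hd1b⟩ := Metric.nhds_basis_closedBall.eventually_iff.1 hpa
    have hγ : ContDiff ℝ n (fun t : ℝ => ((kt.1 + t, kt.2 + t * s t) : ℝ × ℝ)) := by fun_prop
    have hγ1 : ContDiff ℝ 1 (fun t : ℝ => ((kt.1 + t, kt.2 + t * s t) : ℝ × ℝ)) :=
      hγ.of_le (by exact_mod_cast (by omega : 1 ≤ n))
    obtain ⟨L, u, hu, hLip⟩ := (hγ1.contDiffAt (x := 0)).exists_lipschitzOnWith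
    obtain ⟨d2, hd2, hd2u⟩ := Metric.nhds_basis_closedBall.mem_iff.1 hu
    refine ⟨{x | pb x}, hpb, min d (min d1 d2), by positivity, L * C + 1, by positivity, ?_⟩
    intro ε hε p hp0 hp
    set S := {t : ℝ | |t| ≤ min d (min d1 d2) ∧
      |e (p + σ • ((kt.1 + t, kt.2 + t * s t) : ℝ × ℝ))| ≤ ε} with hS
    have hSu : S ⊆ u := fun t ht => hd2u (by
      have := ht.1.trans ((min_le_right _ _).trans (min_le_right _ _))
      simpa using this)
    have hcov : {k : ℝ × ℝ | e k = 0 ∧ ‖k - kt‖ ≤ min d (min d1 d2) ∧ |e (p + σ • k)| ≤ ε ∧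
      ∃ x s : ℝ, x ≠ 0 ∧ s ∈ {x | pb x} ∧ k = (kt.1 + x, kt.2 + x * s)} ⊆
        (fun t : ℝ => ((kt.1 + t, kt.2 + t * s t) : ℝ × ℝ)) '' S := by
      rintro k ⟨hk0, hkd, hke, x, y, hx, hy, rfl⟩
      have hxd := hxle _ _ _ _ rfl hkd
      have hEz : E (x, y) = 0 := by
        rw [hB.eqn] at hk0
        exact (mul_eq_zero.1 hk0).resolve_left (pow_ne_zero _ hx)
      have hyx : y = s x := hab (hd1b (by
        have := hxd.trans ((min_le_right _ _).trans (min_le_left _ _))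
        simpa using this)) hy hEz
      subst hyx
      exact ⟨x, ⟨hxd, hke⟩, rfl⟩
    have hX : 0 ≤ (ε / ‖p - pt‖) ^ ((1 : ℝ) / n₀) := by positivity
    calc _ ≤ μH[1] ((fun t : ℝ => ((kt.1 + t, kt.2 + t * s t) : ℝ × ℝ)) '' S) := measure_mono hcov
      _ ≤ (L : ENNReal) ^ (1 : ℝ) * μH[1] S :=
          (hLip.mono hSu).hausdorffMeasure_image_le zero_le_one
      _ = ENNReal.ofReal L * volume S := by
          rw [hausdorffMeasure_real, ENNReal.rpow_one, ENNReal.ofReal_coe_nnreal]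
      _ ≤ ENNReal.ofReal L * ENNReal.ofReal (C * (ε / ‖p - pt‖) ^ ((1 : ℝ) / n₀)) := by
          gcongr
          refine (measure_mono ?_).trans (hb ε hε p hp0 (hp.trans (min_le_left _ _)))
          exact fun t ht => ⟨ht.1.trans (min_le_left _ _), ht.2⟩
      _ = ENNReal.ofReal (L * (C * (ε / ‖p - pt‖) ^ ((1 : ℝ) / n₀))) :=
          (ENNReal.ofReal_mul L.2).symm
      _ ≤ _ := ENNReal.ofReal_le_ofReal (by rw [← mul_assoc]; gcongr; linarith)
  · have hev : ∀ᶠ z in 𝓝 ((0 : ℝ), s₀), E z ≠ 0 :=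
      hB.cd.continuous.continuousAt.eventually_ne h0
    rw [nhds_prod_eq, Filter.eventually_prod_iff] at hev
    obtain ⟨pa, hpa, pb, hpb, hab⟩ := hev
    obtain ⟨d1, hd1, hd1b⟩ := Metric.nhds_basis_closedBall.eventually_iff.1 hpa
    refine ⟨{x | pb x}, hpb, d1, hd1, 1, one_pos, ?_⟩
    intro ε hε p hp0 hp
    refine le_trans (le_of_eq ?_) zero_le
    refine measure_mono_null (t := ∅) ?_ measure_empty
    rintro k ⟨hk0, hkd, hke, x, y, hx, hy, rfl⟩
    have hxd := hxle _ _ _ _ rfl hkd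
    rw [hB.eqn] at hk0
    exact hab (hd1b (by simpa using hxd)) hy
      ((mul_eq_zero.1 hk0).resolve_left (pow_ne_zero _ hx))

open Topology in
theorem good_Icc {n n₀ : ℕ} (hn : n ≠ 0) {e : ℝ × ℝ → ℝ} (σ : ℝ) (pt kt : ℝ × ℝ)
    {μ : ℕ} {E : ℝ × ℝ → ℝ} (hB : Blow e kt n μ E)
    (hV : ∀ s : ℝ → ℝ, ContDiff ℝ n s → (∀ᶠ t in 𝓝 (0 : ℝ), E (t, s t) = 0) →
      VB e n₀ σ pt kt s) : Good e n₀ σ pt kt (Set.Icc (-1) 1) := by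
  refine isCompact_Icc.induction_on (p := Good e n₀ σ pt kt) ?_ ?_ ?_ ?_
  · exact ⟨1, one_pos, 1, one_pos, by simp⟩
  · rintro S T hST ⟨d, hd, D, hD, h⟩
    refine ⟨d, hd, D, hD, fun ε hε p hp0 hp => (measure_mono ?_).trans (h ε hε p hp0 hp)⟩
    rintro k ⟨h1, h2, h3, x, y, hx, hy, rfl⟩
    exact ⟨h1, h2, h3, x, y, hx, hST hy, rfl⟩
  · rintro S T ⟨d, hd, D, hD, h⟩ ⟨d', hd', D', hD', h'⟩
    refine ⟨min d d', by positivity, D + D', by positivity, fun ε hε p hp0 hp => ?_⟩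
    have h1 := h ε hε p hp0 (hp.trans (min_le_left _ _))
    have h2 := h' ε hε p hp0 (hp.trans (min_le_right _ _))
    rw [add_mul, ENNReal.ofReal_add (by positivity) (by positivity)]
    refine le_trans (measure_mono ?_) ((measure_union_le _ _).trans (add_le_add h1 h2))
    rintro k ⟨h1, h2, h3, x, y, hx, hy | hy, rfl⟩
    · exact Or.inl ⟨h1, h2.trans (min_le_left _ _), h3, x, y, hx, hy, rfl⟩
    · exact Or.inr ⟨h1, h2.trans (min_le_right _ _), h3, x, y, hx, hy, rfl⟩
  · intro s₀ _
    obtain ⟨T, hT, hG⟩ := good_local hn σ pt kt hB hV s₀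
    exact ⟨T, mem_nhdsWithin_of_mem_nhds hT, hG⟩

/-- standing hypotheses in the orientation `k₂ = f (k₁)` -/
structure Hyp (e : ℝ × ℝ → ℝ) (n n₀ : ℕ) : Prop where
  cd : ContDiff ℝ (n + 2 : ℕ) e
  hess : ∀ q, e q = 0 → fderiv ℝ e q = 0 →
    hess2 e q (1, 0) (1, 0) * hess2 e q (0, 1) (0, 1) -
      hess2 e q (1, 0) (0, 1) * hess2 e q (0, 1) (1, 0) ≠ 0
  flat : ∀ kt, e kt = 0 → FlatX e n n₀ kt
  nest : ∀ kt pt : ℝ × ℝ, e kt = 0 → e pt = 0 → kt ≠ pt → NestX e e n n₀ kt pt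
  nestneg : (¬ ∀ k : ℝ × ℝ, e (-k) = e k) → ∀ kt pt : ℝ × ℝ, e kt = 0 → e (-pt) = 0 →
      NestX e (fun k => e (-k)) n n₀ kt pt

open Topology in
theorem vb_one {n n₀ : ℕ} (hn₀ : 3 ≤ n₀) (hn : n₀ + 1 ≤ n) {e : ℝ × ℝ → ℝ} (H : Hyp e n n₀)
    (pt kt : ℝ × ℝ) (hkt : e kt = 0) {μ : ℕ} {E : ℝ × ℝ → ℝ} (hB : Blow e kt n μ E)
    (s : ℝ → ℝ) (hs : ContDiff ℝ n s) (hbr : ∀ᶠ t in 𝓝 (0 : ℝ), E (t, s t) = 0) :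
    VB e n₀ 1 pt kt s := by
  have hen : ContDiff ℝ n e := H.cd.of_le (by exact_mod_cast (by omega : n ≤ n + 2))
  have hz : ∀ᶠ t in 𝓝 (0 : ℝ), e (kt.1 + t, kt.2 + t * s t) = 0 := by
    filter_upwards [hbr] with t ht
    rw [hB.eqn, ht, mul_zero]
  by_cases hpt : pt = 0
  · subst hpt
    obtain ⟨n', rfl⟩ : ∃ n', n = n' + 1 := ⟨n - 1, by omega⟩
    exact vb_nest (by omega) (by omega) hen kt hs hz
      (fun θ hθ => order_nest hn₀ (by omega) H.cd hB (H.flat kt hkt) hs hbr θ hθ)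
  · refine vb_nonnest (by omega) (by omega) hen 1 pt kt hs ?_
    by_cases hq : e (pt + kt) = 0
    · obtain ⟨μ', E', hB'⟩ := blow_exists (n := n) (by omega) H.cd hq (H.hess _ hq)
      obtain ⟨m, hm, hne⟩ := order_nonnest hn₀ (by omega) hen hB'
        (H.nest kt (pt + kt) hkt hq (by simpa using hpt)) hs hz
      refine ⟨m, hm, ?_⟩
      have hfun : (fun t : ℝ => e (pt + (1 : ℝ) • ((kt.1 + t, kt.2 + t * s t) : ℝ × ℝ))) =
          fun t : ℝ => e ((pt + kt).1 + t, (pt + kt).2 + t * s t) := by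
        funext t
        congr 1
        ext <;> simp <;> ring
      rw [hfun]
      exact hne
    · refine ⟨0, Nat.zero_le _, ?_⟩
      simpa using hq

open Topology in
theorem vb_neg {n n₀ : ℕ} (hn₀ : 3 ≤ n₀) (hn : n₀ + 1 ≤ n) {e : ℝ × ℝ → ℝ} (H : Hyp e n n₀)
    (pt kt : ℝ × ℝ) (hkt : e kt = 0) {μ : ℕ} {E : ℝ × ℝ → ℝ} (hB : Blow e kt n μ E)
    (s : ℝ → ℝ) (hs : ContDiff ℝ n s) (hbr : ∀ᶠ t in 𝓝 (0 : ℝ), E (t, s t) = 0) :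
    VB e n₀ (-1) pt kt s := by
  have hen : ContDiff ℝ n e := H.cd.of_le (by exact_mod_cast (by omega : n ≤ n + 2))
  have hz : ∀ᶠ t in 𝓝 (0 : ℝ), e (kt.1 + t, kt.2 + t * s t) = 0 := by
    filter_upwards [hbr] with t ht
    rw [hB.eqn, ht, mul_zero]
  by_cases heven : ∀ k : ℝ × ℝ, e (-k) = e k
  · obtain ⟨d, hd, C, hC, h⟩ := vb_one hn₀ hn H (-pt) kt hkt hB s hs hbr
    refine ⟨d, hd, C, hC, fun ε hε p hp0 hp => ?_⟩
    have hnorm : ‖-p - -pt‖ = ‖p - pt‖ := by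
      rw [← norm_neg]; congr 1; abel
    have := h ε hε (-p) (by rwa [hnorm]) (by rwa [hnorm])
    rw [hnorm] at this
    refine le_trans (measure_mono ?_) this
    intro t ht
    refine ⟨ht.1, ?_⟩
    have h2 := ht.2
    rw [← heven] at h2
    convert h2 using 3
    simp only [neg_smul, neg_add, neg_neg]
  · refine vb_nonnest (by omega) (by omega) hen (-1) pt kt hs ?_
    by_cases hq : e (pt - kt) = 0
    · obtain ⟨μ', E', hB'⟩ := blow_exists (n := n) (by omega) H.cd hq (H.hess _ hq)
      obtain ⟨m, hm, hne⟩ := order_nonnest hn₀ (by omega) (hen.comp contDiff_neg)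
        (hB'.neg (by omega))
        (H.nestneg heven kt (-(pt - kt)) hkt (by rwa [neg_neg])) hs hz
      refine ⟨m, hm, ?_⟩
      convert hne using 3 with t
      simp only [Function.comp]
      congr 1
      ext <;> simp <;> ring
    · refine ⟨0, Nat.zero_le _, ?_⟩
      have hpk : pt + (-1 : ℝ) • ((kt.1 + 0, kt.2 + 0 * s 0) : ℝ × ℝ) = pt - kt := by
        ext <;> simp <;> ring
      rw [iteratedDeriv_zero, hpk]
      exact hq

theorem halfX {n n₀ : ℕ} (hn₀ : 3 ≤ n₀) (hn : n₀ + 1 ≤ n) {e : ℝ × ℝ → ℝ} (H : Hyp e n n₀)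
    (pt kt : ℝ × ℝ) (hkt : e kt = 0) (σ : ℝ) (hσ : σ = 1 ∨ σ = -1) :
    Good e n₀ σ pt kt (Set.Icc (-1) 1) := by
  obtain ⟨μ, E, hB⟩ := blow_exists (n := n) (by omega) H.cd hkt (H.hess _ hkt)
  refine good_Icc (by omega) σ pt kt hB fun s hs hbr => ?_
  rcases hσ with rfl | rfl
  · exact vb_one hn₀ hn H pt kt hkt hB s hs hbr
  · exact vb_neg hn₀ hn H pt kt hkt hB s hs hbr

theorem hess_det {e : ℝ × ℝ → ℝ} {q : ℝ × ℝ} (h : HessCond e q) :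
    hess2 e q (1, 0) (1, 0) * hess2 e q (0, 1) (0, 1) -
      hess2 e q (1, 0) (0, 1) * hess2 e q (0, 1) (1, 0) ≠ 0 := by
  obtain ⟨μ₁, μ₂, h1, h2, h3⟩ := h
  have h4 := congrArg (Polynomial.eval 0) h3
  rw [Matrix.charpoly_fin_two, Matrix.det_fin_two] at h4
  simp at h4
  have h5 : μ₁ * μ₂ < 0 := mul_neg_of_pos_of_neg h1 h2
  intro h6
  linarith

theorem fderiv_swap {e : ℝ × ℝ → ℝ} (he : Differentiable ℝ e) (q u : ℝ × ℝ) :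
    fderiv ℝ (fun k : ℝ × ℝ => e k.swap) q u = fderiv ℝ e q.swap u.swap := by
  have h1 : HasFDerivAt (fun k : ℝ × ℝ => k.swap)
      ((ContinuousLinearMap.snd ℝ ℝ ℝ).prod (ContinuousLinearMap.fst ℝ ℝ ℝ)) q :=
    ((ContinuousLinearMap.snd ℝ ℝ ℝ).prod (ContinuousLinearMap.fst ℝ ℝ ℝ)).hasFDerivAt
  have h2 := ((he q.swap).hasFDerivAt).comp q h1
  have h3 : fderiv ℝ (fun k : ℝ × ℝ => e k.swap) q = _ := h2.fderiv
  rw [h3]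
  rfl

theorem hess2_swap {e : ℝ × ℝ → ℝ} (he : ContDiff ℝ 2 e) (q u v : ℝ × ℝ) :
    hess2 (fun k : ℝ × ℝ => e k.swap) q u v = hess2 e q.swap u.swap v.swap := by
  unfold hess2
  have h1 : (fun q => fderiv ℝ (fun k : ℝ × ℝ => e k.swap) q u) =
      fun k : ℝ × ℝ => (fun q => fderiv ℝ e q u.swap) k.swap := by
    funext k
    exact fderiv_swap (he.differentiable (by norm_num)) k u
  rw [h1]
  refine fderiv_swap (e := fun q => fderiv ℝ e q u.swap) ?_ q v
  have h2 : ContDiff ℝ 1 (fderiv ℝ e) := he.fderiv_right (by norm_num)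
  have h3 := h2.differentiable (by norm_num)
  exact fun x => (h3 x).clm_apply (differentiableAt_const _)

theorem hyp_swap_swap (u : ℝ × ℝ) : u.swap.swap = u := rfl

theorem hyp_of {n₀ r : ℕ} (hn₀ : 3 ≤ n₀) (hr : 2 * n₀ + 1 ≤ r)
    {e : ℝ × ℝ → ℝ} (he : ContDiff ℝ r e)
    (hH4 : ∀ k : ℝ × ℝ, e k = 0 → fderiv ℝ e k = 0 → HessCond e k)
    (hH5 : NonFlatCond e r n₀) (hH6 : NoNestingCond e r n₀) : Hyp e (r - 2) n₀ where
  cd := by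
    have : r - 2 + 2 = r := by omega
    rwa [this]
  hess := fun q h0 h1 => hess_det (hH4 q h0 h1)
  flat := fun kt h => (hH5 kt h).1
  nest := fun kt pt h1 h2 h3 => (hH6.1 kt pt h1 h2 h3).1
  nestneg := fun h kt pt h1 h2 => (hH6.2 h kt pt h1 h2).1

theorem hyp_swap {n₀ r : ℕ} (hn₀ : 3 ≤ n₀) (hr : 2 * n₀ + 1 ≤ r)
    {e : ℝ × ℝ → ℝ} (he : ContDiff ℝ r e)
    (hH4 : ∀ k : ℝ × ℝ, e k = 0 → fderiv ℝ e k = 0 → HessCond e k)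
    (hH5 : NonFlatCond e r n₀) (hH6 : NoNestingCond e r n₀) :
    Hyp (fun k => e k.swap) (r - 2) n₀ where
  cd := by
    have : r - 2 + 2 = r := by omega
    rw [this]
    exact he.comp (contDiff_snd.prodMk contDiff_fst)
  hess := fun q h0 h1 => by
    have he2 : ContDiff ℝ 2 e := he.of_le (by exact_mod_cast (by omega : 2 ≤ r))
    have h2 : fderiv ℝ e q.swap = 0 := by
      ext1 <;> ext
      · have := fderiv_swap (he2.differentiable (by norm_num)) q (0, 1)
        rw [h1] at this
        simpa using this.symm
      · have := fderiv_swap (he2.differentiable (by norm_num)) q (1, 0)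
        rw [h1] at this
        simpa using this.symm
    have h3 := hess_det (hH4 q.swap h0 h2)
    simp only [hess2_swap he2, Prod.swap_prod_mk]
    intro h4
    apply h3
    linarith
  flat := fun kt h => (hH5 kt.swap h).2
  nest := fun kt pt h1 h2 h3 =>
    (hH6.1 kt.swap pt.swap h1 h2 (fun h => h3 (Prod.swap_injective h))).2
  nestneg := fun h kt pt h1 h2 =>
    (hH6.2 (fun h' => h (fun k => h' k.swap)) kt.swap pt.swap h1 h2).2

theorem good_all {n₀ r : ℕ} (hn₀ : 3 ≤ n₀) (hr : 2 * n₀ + 1 ≤ r)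
    {e : ℝ × ℝ → ℝ} (he : ContDiff ℝ r e)
    (hH4 : ∀ k : ℝ × ℝ, e k = 0 → fderiv ℝ e k = 0 → HessCond e k)
    (hH5 : NonFlatCond e r n₀) (hH6 : NoNestingCond e r n₀)
    (pt kt : ℝ × ℝ) (hkt : e kt = 0) (σ : ℝ) (hσ : σ = 1 ∨ σ = -1) :
    ∃ d > 0, ∃ D > 0, ∀ d' ≤ d, ∀ ε > 0, ∀ p : ℝ × ℝ, 0 < ‖p - pt‖ → ‖p - pt‖ ≤ d' →
      μH[1] {k : ℝ × ℝ | e k = 0 ∧ ‖k - kt‖ ≤ d' ∧ |e (p + σ • k)| ≤ ε} ≤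
        ENNReal.ofReal (D * (ε / ‖p - pt‖) ^ ((1 : ℝ) / n₀)) := by
  obtain ⟨d₁, hd₁, D₁, hD₁, h₁⟩ := halfX hn₀ (by omega) (hyp_of hn₀ hr he hH4 hH5 hH6)
    pt kt hkt σ hσ
  obtain ⟨d₂, hd₂, D₂, hD₂, h₂⟩ := halfX hn₀ (by omega) (hyp_swap hn₀ hr he hH4 hH5 hH6)
    pt.swap kt.swap hkt σ hσ
  refine ⟨min d₁ d₂, by positivity, D₁ + D₂, by positivity, ?_⟩
  intro d' hd' ε hε p hp0 hp
  have hsw : ∀ u v : ℝ × ℝ, ‖u.swap - v.swap‖ = ‖u - v‖ := by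
    intro u v
    simp [Prod.norm_def, max_comm]
  have hiso : Isometry (Prod.swap : ℝ × ℝ → ℝ × ℝ) := by
    refine Isometry.of_dist_eq fun u v => ?_
    rw [dist_eq_norm, dist_eq_norm, hsw]
  have a₁ := h₁ ε hε p hp0 ((hp.trans hd').trans (min_le_left _ _))
  have a₂ := h₂ ε hε p.swap (by rwa [hsw]) (by rw [hsw]; exact (hp.trans hd').trans (min_le_right _ _))
  rw [hsw, ← hiso.hausdorffMeasure_image (Or.inl zero_le_one)] at a₂
  rw [add_mul, ENNReal.ofReal_add (by positivity) (by positivity)]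
  have hnull : μH[1] ({kt} : Set (ℝ × ℝ)) = 0 := by
    have := Measure.noAtoms_hausdorff (ℝ × ℝ) (d := 1) one_pos
    exact measure_singleton kt
  have hu := (measure_union_le (μ := (μH[1] : Measure (ℝ × ℝ))) _ _).trans (add_le_add a₁ a₂)
  have hu2 := (measure_union_le (μ := (μH[1] : Measure (ℝ × ℝ))) {kt} _).trans
    (add_le_add hnull.le hu)
  rw [zero_add] at hu2
  refine le_trans (measure_mono ?_) hu2
  rintro k ⟨hk0, hkd, hke⟩
  by_cases hk : k = kt
  · exact Or.inl hk
  right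
  have hkd₁ := hkd.trans (hd'.trans (min_le_left _ _))
  have hkd₂ := hkd.trans (hd'.trans (min_le_right _ _))
  rcases le_total |k.2 - kt.2| |k.1 - kt.1| with hle | hle
  · left
    have hx : k.1 - kt.1 ≠ 0 := by
      intro h0
      rw [h0, abs_zero] at hle
      have := abs_nonpos_iff.1 hle
      exact hk (Prod.ext (by linarith) (by linarith))
    refine ⟨hk0, hkd₁, hke, k.1 - kt.1, (k.2 - kt.2) / (k.1 - kt.1), hx, ?_, ?_⟩
    · rw [Set.mem_Icc, ← abs_le, abs_div]
      exact div_le_one_of_le₀ hle (abs_nonneg _)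
    · rw [mul_div_cancel₀ _ hx]
      ext <;> simp
  · right
    have hx : k.2 - kt.2 ≠ 0 := by
      intro h0
      rw [h0, abs_zero] at hle
      have := abs_nonpos_iff.1 hle
      exact hk (Prod.ext (by linarith) (by linarith))
    refine ⟨k.swap, ⟨hk0, by rwa [hsw], hke, k.2 - kt.2, (k.1 - kt.1) / (k.2 - kt.2), hx, ?_, ?_⟩, rfl⟩
    · rw [Set.mem_Icc, ← abs_le, abs_div]
      exact div_le_one_of_le₀ hle (abs_nonneg _)
    · rw [mul_div_cancel₀ _ hx]
      ext <;> simp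

/-- **Length of overlap, local version.** Under (H1)–(H6), for each `pt ∈ ℝ²` and `kt ∈ F`
there are `d, D' > 0` such that for each sign `σ`, each integer `j < 0` and each `p` with
`0 < |p - pt| ≤ d`, the arc length of `{k ∈ F : |k - kt| ≤ d, |e (p + σ k)| ≤ M^j}` is at
most `D' (M^j / |p - pt|)^(1/n₀)`. -/
theorem stmt_3 (n₀ r : ℕ) (hn₀ : 3 ≤ n₀) (hr : 2 * n₀ + 1 ≤ r)
    (e : ℝ × ℝ → ℝ) (he : ContDiff ℝ r e)
    (hH1 : IsCompact {k : ℝ × ℝ | |e k| ≤ 1})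
    (hH3 : {k : ℝ × ℝ | e k = 0 ∧ fderiv ℝ e k = 0}.Finite)
    (hH4 : ∀ k : ℝ × ℝ, e k = 0 → fderiv ℝ e k = 0 → HessCond e k)
    (hH5 : NonFlatCond e r n₀) (hH6 : NoNestingCond e r n₀)
    (M : ℝ) (hM : 1 < M)
    (pt kt : ℝ × ℝ) (hkt : e kt = 0) :
    ∃ d D' : ℝ, 0 < d ∧ 0 < D' ∧ ∀ σ : ℝ, (σ = 1 ∨ σ = -1) → ∀ j : ℤ, j < 0 →
      ∀ p : ℝ × ℝ, 0 < ‖p - pt‖ → ‖p - pt‖ ≤ d →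
        μH[1] {k : ℝ × ℝ | e k = 0 ∧ ‖k - kt‖ ≤ d ∧ |e (p + σ • k)| ≤ M ^ j} ≤
          ENNReal.ofReal (D' * (M ^ j / ‖p - pt‖) ^ ((1 : ℝ) / n₀)) := by
  obtain ⟨d₁, hd₁, D₁, hD₁, h₁⟩ := good_all hn₀ hr he hH4 hH5 hH6 pt kt hkt 1 (Or.inl rfl)
  obtain ⟨d₂, hd₂, D₂, hD₂, h₂⟩ := good_all hn₀ hr he hH4 hH5 hH6 pt kt hkt (-1) (Or.inr rfl)
  refine ⟨min d₁ d₂, D₁ + D₂, by positivity, by positivity, ?_⟩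
  intro σ hσ j _ p hp0 hp
  have hε : 0 < M ^ j := zpow_pos (by linarith) j
  rcases hσ with rfl | rfl
  · refine (h₁ _ (min_le_left _ _) _ hε p hp0 hp).trans (ENNReal.ofReal_le_ofReal ?_)
    gcongr
    linarith
  · refine (h₂ _ (min_le_right _ _) _ hε p hp0 hp).trans (ENNReal.ofReal_le_ofReal ?_)
    gcongr
    linarith
end
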